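/- Suppose γ > 0, 1 < q < ∞, α ∈ ℝ, 0 < p < ∞, and k is a nonnegative integer with pk + α > −1. For a holomorphic function f on 𝔹_n, the following are equivalent: (1) f belongs to the generalized Bergman space A^p_α; (2) A_γ^{(q)}(R^k f) ∈ L^p(𝔹_n, dv_α), where A_γ^{(q)}(R^k f)(z) = (∫_{D(z,γ)} |(1−|u|²)^k R^k f(u)|^q dτ(u))^{1/q}; (3) M_γ^{(q)}(R^k f) ∈ L^p(𝔹_n, dv_α), where M_γ^{(q)}(R^k f)(z) = sup{ (∫_{D(w,γ)} |(1−|u|²)^k R^k f(u)|^q dv_α(u)/v_α(D(w,γ)))^{1/q} : w ∈ 𝔹_n with z ∈ D(w,γ) }. Moreover, ‖f‖_{p,α}, |f(0)| + ‖A_γ^{(q)}(R^k f)‖_{L^p(dv_α)}, and |f(0)| + ‖M_γ^{(q)}(R^k f)‖_{L^p(dv_α)} are pairwise comparable with constants depending only on γ, q, α, p, k, n. -/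

import Mathlib

open MeasureTheory Filter Topology
open scoped Classical ENNReal

noncomputable section

/-- `ℂⁿ` with the Euclidean norm. -/
abbrev En (n : ℕ) := EuclideanSpace ℂ (Fin n)

instance (n : ℕ) : MeasurableSpace (En n) := borel _
instance (n : ℕ) : BorelSpace (En n) := ⟨rfl⟩

/-- The Lebesgue volume measure on `ℂⁿ`. -/
def vol (n : ℕ) : Measure (En n) := Measure.addHaar

/-- The open unit ball `𝔹ₙ` of `ℂⁿ`. -/
def uball (n : ℕ) : Set (En n) := Metric.ball 0 1

/-- The Hermitian pairing `⟨z,w⟩ = ∑ⱼ zⱼ * conj wⱼ`. -/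
def herm {n : ℕ} (z w : En n) : ℂ := ∑ j, z j * (starRingEnd ℂ) (w j)

/-- The orthogonal projection `P_z w` onto the line spanned by `z`. -/
def prj {n : ℕ} (z w : En n) : En n :=
  if z = 0 then 0 else (herm w z / herm z z) • z

/-- The Möbius automorphism `φ_z` of the unit ball. -/
def mobius {n : ℕ} (z w : En n) : En n :=
  ((1 : ℂ) / (1 - herm w z)) •
    (z - prj z w - ((Real.sqrt (1 - ‖z‖ ^ 2) : ℝ) : ℂ) • (w - prj z w))

/-- The Bergman metric `β(z,w)`. -/
def bmet {n : ℕ} (z w : En n) : ℝ :=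
  (1 / 2) * Real.log ((1 + ‖mobius z w‖) / (1 - ‖mobius z w‖))

/-- The Bergman metric ball `D(z,γ)`. -/
def Dball {n : ℕ} (z : En n) (γ : ℝ) : Set (En n) :=
  {w | w ∈ uball n ∧ bmet z w < γ}

/-- The normalizing constant `c_α`. -/
def cnorm (n : ℕ) (α : ℝ) : ℝ :=
  if -1 < α then Real.Gamma (n + α + 1) / (n.factorial * Real.Gamma (α + 1)) else 1

/-- The weighted measure `dv_α = c_α (1-|z|²)^α dv` on the unit ball. -/
def measA (n : ℕ) (α : ℝ) : Measure (En n) :=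
  ((vol n).restrict (uball n)).withDensity
    (fun z => ENNReal.ofReal (cnorm n α * (1 - ‖z‖ ^ 2) ^ α))

/-- The invariant measure `dτ = (1-|z|²)^{-(n+1)} dv` on the unit ball. -/
def measTau (n : ℕ) : Measure (En n) :=
  ((vol n).restrict (uball n)).withDensity
    (fun z => ENNReal.ofReal ((1 - ‖z‖ ^ 2) ^ (-((n : ℝ) + 1))))

/-- The Bergman space (quasi-)norm `‖f‖_{p,α}`, valued in `ℝ≥0∞`. -/
def apnorm (n : ℕ) (p α : ℝ) (f : En n → ℂ) : ℝ≥0∞ :=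
  (∫⁻ z, ENNReal.ofReal (‖f z‖ ^ p) ∂measA n α) ^ (1 / p)

/-- The radial derivative `Rf(z) = ∑ z_k ∂f/∂z_k = Df(z)[z]`. -/
def radD {n : ℕ} (f : En n → ℂ) (z : En n) : ℂ := fderiv ℂ f z z

/-- Iterated radial derivative `R^k f`. -/
def radIter {n : ℕ} : ℕ → (En n → ℂ) → En n → ℂ
  | 0, f => f
  | (k + 1), f => radD (radIter k f)

/-- The pseudo-metric `ϱ` on the unit ball. -/
def rho {n : ℕ} (z w : En n) : ℝ :=
  if z ≠ 0 ∧ w ≠ 0 then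
    |‖z‖ - ‖w‖| + ‖1 - herm z w / ((‖z‖ : ℂ) * (‖w‖ : ℂ))‖
  else ‖z‖ + ‖w‖

/-- The area integral `A_γ^{(q)} g(z) = (∫_{D(z,γ)} g(w)^q dτ(w))^{1/q}`, valued in `ℝ≥0∞`. -/
def areaF {n : ℕ} (γ q : ℝ) (g : En n → ℝ) (z : En n) : ℝ≥0∞ :=
  (∫⁻ w in Dball z γ, ENNReal.ofReal (g w) ^ q ∂measTau n) ^ (1 / q)

/-- The Bergman-ball Hardy–Littlewood type maximal function
`M_γ^{(q)} g(z) = sup { (v_α(D(w,γ))⁻¹ ∫_{D(w,γ)} g^q dv_α)^{1/q} : w ∈ 𝔹ₙ, z ∈ D(w,γ) }`. -/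
def maxHL {n : ℕ} (γ q α : ℝ) (g : En n → ℝ) (z : En n) : ℝ≥0∞ :=
  ⨆ w ∈ {w : En n | w ∈ uball n ∧ z ∈ Dball w γ},
    ((measA n α (Dball w γ))⁻¹ *
      ∫⁻ u in Dball w γ, ENNReal.ofReal (g u) ^ q ∂measA n α) ^ (1 / q)

/-- The smallest nonnegative integer `N` with `pN + α > -1`. -/
def Nmin (p α : ℝ) : ℕ := sInf {k : ℕ | p * k + α > -1}

/-- The norm of the generalized Bergman space `A^p_α`,
`‖f‖_{p,α} = |f(0)| + (∫ (1-|z|²)^{pN} |R^N f|^p dv_α)^{1/p}` with `N = Nmin p α`. -/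
def gapnorm (n : ℕ) (p α : ℝ) (f : En n → ℂ) : ℝ≥0∞ :=
  ENNReal.ofReal ‖f 0‖ +
    (∫⁻ z, ENNReal.ofReal ((1 - ‖z‖ ^ 2) ^ (p * Nmin p α) *
        ‖radIter (Nmin p α) f z‖ ^ p) ∂measA n α) ^ (1 / p)

set_option linter.unusedSectionVars false


/-! ### Geometry -/

def btQ {E : Type*} [NormedAddCommGroup E] [InnerProductSpace ℂ E] (K : ℝ) (z : E) : Set E :=
  {u | ‖u‖ < 1 ∧ ‖1 - inner ℂ z u‖ ^ 2 < K * ((1 - ‖z‖ ^ 2) * (1 - ‖u‖ ^ 2))}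

section geom
variable {E : Type*} [NormedAddCommGroup E] [InnerProductSpace ℂ E]

lemma bt_wt_pos {z : E} (hz : ‖z‖ < 1) : 0 < 1 - ‖z‖ ^ 2 := by
  nlinarith [norm_nonneg z]

lemma bt_wt_le (z : E) : 1 - ‖z‖ ^ 2 ≤ 1 := by
  nlinarith [norm_nonneg z]

lemma bt_norm_symm (z u : E) : ‖1 - inner ℂ z u‖ = ‖1 - inner ℂ u z‖ := by
  rw [← Complex.norm_conj, map_sub, map_one, inner_conj_symm]

lemma bt_Q_symm {K : ℝ} {z u : E} (hz : ‖z‖ < 1) (h : u ∈ btQ K z) : z ∈ btQ K u := by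
  refine ⟨hz, ?_⟩
  rw [bt_norm_symm, mul_comm (1 - ‖u‖ ^ 2)]
  exact h.2

lemma bt_lower (z u : E) (hz : ‖z‖ < 1) (hu : ‖u‖ < 1) :
    1 - ‖u‖ ^ 2 ≤ 2 * ‖1 - inner ℂ z u‖ := by
  have h1 : ‖(inner ℂ z u : ℂ)‖ ≤ ‖z‖ * ‖u‖ := norm_inner_le_norm z u
  have h2 : 1 - ‖(inner ℂ z u : ℂ)‖ ≤ ‖1 - (inner ℂ z u : ℂ)‖ := by
    have := norm_sub_norm_le (1 : ℂ) (inner ℂ z u)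
    simpa using this
  nlinarith [norm_nonneg z, norm_nonneg u]

lemma bt_Q_comp {K : ℝ} {z u : E} (hz : ‖z‖ < 1) (h : u ∈ btQ K z) :
    1 - ‖u‖ ^ 2 < 4 * K * (1 - ‖z‖ ^ 2) := by
  have h1 := bt_lower z u hz h.1
  have h2 := h.2
  have h3 := bt_wt_pos h.1
  have h4 := bt_wt_pos hz
  have : (1 - ‖u‖ ^ 2) * (1 - ‖u‖ ^ 2) < (4 * K * (1 - ‖z‖ ^ 2)) * (1 - ‖u‖ ^ 2) := by
    nlinarith
  exact lt_of_mul_lt_mul_right this h3.le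

lemma bt_Q_comp' {K : ℝ} {z u : E} (hz : ‖z‖ < 1) (h : u ∈ btQ K z) :
    1 - ‖z‖ ^ 2 < 4 * K * (1 - ‖u‖ ^ 2) := bt_Q_comp h.1 (bt_Q_symm hz h)

lemma bt_Q_Kpos {K : ℝ} {z u : E} (hz : ‖z‖ < 1) (h : u ∈ btQ K z) : 0 < K := by
  have h1 := bt_Q_comp hz h
  have h3 := bt_wt_pos h.1
  have h4 := bt_wt_pos hz
  by_contra hK
  push Not at hK
  nlinarith

lemma bt_dist (z u : E) (hz : ‖z‖ < 1) (hu : ‖u‖ < 1) :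
    ‖z - u‖ ^ 2 ≤ 2 * ‖1 - inner ℂ z u‖ := by
  have h := norm_sub_sq (𝕜 := ℂ) z u
  have h2 : 1 - RCLike.re (inner ℂ z u : ℂ) ≤ ‖1 - (inner ℂ z u : ℂ)‖ := by
    have := Complex.re_le_norm (1 - (inner ℂ z u : ℂ))
    simpa using this
  nlinarith [norm_nonneg z, norm_nonneg u]

lemma bt_quasi (z u v : E) (hz : ‖z‖ < 1) (hu : ‖u‖ < 1) (hv : ‖v‖ < 1) :
    ‖1 - inner ℂ z v‖ ≤ 4 * (‖1 - inner ℂ z u‖ + ‖1 - inner ℂ u v‖) := by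
  have e : (1 - inner ℂ z v : ℂ) = (1 - inner ℂ z u) + (1 - inner ℂ u v)
      - (((1 - ‖u‖ ^ 2 : ℝ)) : ℂ) + inner ℂ (z - u) (u - v) := by
    simp only [inner_sub_left, inner_sub_right, inner_self_eq_norm_sq_to_K]
    push_cast
    simp
    ring
  have h1 := bt_dist z u hz hu
  have h2 := bt_dist u v hu hv
  have h3 := bt_lower z u hz hu
  have h4 : ‖(inner ℂ (z - u) (u - v) : ℂ)‖ ≤ ‖z - u‖ * ‖u - v‖ := norm_inner_le_norm _ _
  have h5 : ‖(((1 - ‖u‖ ^ 2 : ℝ)) : ℂ)‖ = 1 - ‖u‖ ^ 2 := by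
    rw [Complex.norm_real, Real.norm_of_nonneg (bt_wt_pos hu).le]
  rw [e]
  have := norm_add_le ((1 - inner ℂ z u : ℂ) + (1 - inner ℂ u v)
      - (((1 - ‖u‖ ^ 2 : ℝ)) : ℂ)) (inner ℂ (z - u) (u - v))
  have h6 := norm_sub_le ((1 - inner ℂ z u : ℂ) + (1 - inner ℂ u v)) (((1 - ‖u‖ ^ 2 : ℝ)) : ℂ)
  have h7 := norm_add_le (1 - inner ℂ z u : ℂ) (1 - inner ℂ u v)
  nlinarith [sq_nonneg (‖z - u‖ - ‖u - v‖), norm_nonneg (1 - inner ℂ u v : ℂ),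
    norm_nonneg (1 - inner ℂ z u : ℂ)]

lemma bt_Q_trans {K L : ℝ} {z u v : E} (hz : ‖z‖ < 1) (h : u ∈ btQ K z) (h' : v ∈ btQ L u) :
    v ∈ btQ (256 * K * L) z := by
  refine ⟨h'.1, ?_⟩
  have hK := bt_Q_Kpos hz h
  have hL := bt_Q_Kpos h.1 h'
  have h1 := bt_quasi z u v hz h.1 h'.1
  have h2 := bt_Q_comp hz h
  have h3 := bt_Q_comp' h.1 h'
  have h4 := h.2
  have h5 := h'.2
  have wz := bt_wt_pos hz
  have wu := bt_wt_pos h.1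
  have wv := bt_wt_pos h'.1
  set a := ‖1 - inner ℂ z u‖
  set b := ‖1 - inner ℂ u v‖
  set c := ‖1 - inner ℂ z v‖
  have hc : c ^ 2 ≤ 32 * (a ^ 2 + b ^ 2) := by
    have : 0 ≤ c := norm_nonneg _
    have : 0 ≤ a := norm_nonneg _
    have : 0 ≤ b := norm_nonneg _
    nlinarith [sq_nonneg (a - b), mul_self_le_mul_self ‹0 ≤ c› h1]
  have k1 : K * ((1 - ‖z‖ ^ 2) * (1 - ‖u‖ ^ 2)) ≤ K * ((1 - ‖z‖ ^ 2) * (4 * L * (1 - ‖v‖ ^ 2))) := by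
    gcongr
  have k2 : L * ((1 - ‖u‖ ^ 2) * (1 - ‖v‖ ^ 2)) ≤ L * ((4 * K * (1 - ‖z‖ ^ 2)) * (1 - ‖v‖ ^ 2)) := by
    gcongr
  nlinarith

lemma bt_Q_mono {K L : ℝ} (hKL : K ≤ L) {z : E} (hz : ‖z‖ < 1) : btQ K z ⊆ btQ L z := by
  intro u hu
  refine ⟨hu.1, hu.2.trans_le ?_⟩
  have := mul_pos (bt_wt_pos hz) (bt_wt_pos hu.1)
  gcongr

lemma bt_Q_open (K : ℝ) : IsOpen {x : E × E | x.2 ∈ btQ K x.1} := by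
  have h1 : IsOpen {x : E × E | ‖x.2‖ < 1} := isOpen_lt (by fun_prop) (by fun_prop)
  have h2 : IsOpen {x : E × E | ‖(1 : ℂ) - inner ℂ x.1 x.2‖ ^ 2 <
      K * ((1 - ‖x.1‖ ^ 2) * (1 - ‖x.2‖ ^ 2))} := isOpen_lt (by fun_prop) (by fun_prop)
  exact h1.inter h2

/-- the anisotropic scaling -/
def btA (z : E) : E →ₗ[ℂ] E :=
  ((√(1 - ‖z‖ ^ 2) : ℝ) : ℂ) • LinearMap.transvection
    ((innerSL ℂ z).toLinearMap) (-((1 / (1 + √(1 - ‖z‖ ^ 2)) : ℝ) : ℂ) • z)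

lemma btA_apply (z ξ : E) : btA z ξ = ((√(1 - ‖z‖ ^ 2) : ℝ) : ℂ) •
    (ξ - (((1 / (1 + √(1 - ‖z‖ ^ 2)) : ℝ) : ℂ) * inner ℂ z ξ) • z) := by
  simp only [btA, LinearMap.smul_apply, LinearMap.transvection.apply,
    ContinuousLinearMap.coe_coe, innerSL_apply_apply, smul_smul]
  congr 1
  rw [mul_neg, neg_smul, ← sub_eq_add_neg, mul_comm]

lemma btA_inner (z ξ : E) (hz : ‖z‖ < 1) :
    inner ℂ z (btA z ξ) = ((1 - ‖z‖ ^ 2 : ℝ) : ℂ) * inner ℂ z ξ := by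
  rw [btA_apply, inner_smul_right, inner_sub_right, inner_smul_right,
    inner_self_eq_norm_sq_to_K]
  have hs := Real.sq_sqrt (bt_wt_pos hz).le
  have hs0 := Real.sqrt_nonneg (1 - ‖z‖ ^ 2)
  set s := √(1 - ‖z‖ ^ 2)
  have e : s * (1 - 1 / (1 + s) * ‖z‖ ^ 2) = 1 - ‖z‖ ^ 2 := by
    have : (1 + s) ≠ 0 := by positivity
    field_simp
    nlinarith
  rw [← e]
  push_cast
  simp
  ring

lemma btA_norm (z ξ : E) (hz : ‖z‖ < 1) :
    ‖btA z ξ‖ ^ 2 = (1 - ‖z‖ ^ 2) * (‖ξ‖ ^ 2 - ‖(inner ℂ z ξ : ℂ)‖ ^ 2) := by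
  have hs := Real.sq_sqrt (bt_wt_pos hz).le
  have hs0 := Real.sqrt_nonneg (1 - ‖z‖ ^ 2)
  rw [btA_apply, norm_smul, mul_pow, norm_sub_sq (𝕜 := ℂ), inner_smul_right]
  rw [Complex.norm_real, Real.norm_of_nonneg hs0, hs, norm_smul, norm_mul, Complex.norm_real]
  congr 1
  set s := √(1 - ‖z‖ ^ 2)
  have h1s : (1 + s) ≠ 0 := by positivity
  have : RCLike.re ((((1 / (1 + s) : ℝ) : ℂ) * inner ℂ z ξ) * inner ℂ ξ z)
      = 1 / (1 + s) * ‖(inner ℂ z ξ : ℂ)‖ ^ 2 := by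
    rw [mul_assoc, ← inner_conj_symm ξ z, Complex.mul_conj, Complex.normSq_eq_norm_sq,
      ← Complex.ofReal_mul]
    exact Complex.ofReal_re _
  rw [this, Real.norm_of_nonneg (by positivity)]
  field_simp
  nlinarith

lemma bt_wt_btA (z ξ : E) (hz : ‖z‖ < 1) :
    1 - ‖z + btA z ξ‖ ^ 2 = (1 - ‖z‖ ^ 2) * (‖1 - (inner ℂ z ξ : ℂ)‖ ^ 2 - ‖ξ‖ ^ 2) := by
  rw [norm_add_sq (𝕜 := ℂ), btA_norm z ξ hz, btA_inner z ξ hz]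
  have h1 : ‖1 - (inner ℂ z ξ : ℂ)‖ ^ 2 = 1 - 2 * (inner ℂ z ξ : ℂ).re
      + ‖(inner ℂ z ξ : ℂ)‖ ^ 2 := by
    rw [← Complex.normSq_eq_norm_sq, ← Complex.normSq_eq_norm_sq, Complex.normSq_apply,
      Complex.normSq_apply]
    simp
    ring
  rw [h1]
  simp only [RCLike.re_to_complex, Complex.re_ofReal_mul]
  ring

lemma bt_inner_btA (z ξ : E) (hz : ‖z‖ < 1) :
    ‖1 - (inner ℂ z (z + btA z ξ) : ℂ)‖ = (1 - ‖z‖ ^ 2) * ‖1 - (inner ℂ z ξ : ℂ)‖ := by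
  rw [inner_add_right, btA_inner z ξ hz, inner_self_eq_norm_sq_to_K]
  have : (1 - ((‖z‖ : ℂ) ^ 2 + ((1 - ‖z‖ ^ 2 : ℝ) : ℂ) * inner ℂ z ξ))
    = ((1 - ‖z‖ ^ 2 : ℝ) : ℂ) * (1 - inner ℂ z ξ) := by
    push_cast
    ring
  simp only [Complex.coe_algebraMap]
  rw [this, norm_mul, Complex.norm_real, Real.norm_of_nonneg (bt_wt_pos hz).le]

lemma bt_exists_eps {K : ℝ} (hK : 1 < K) : ∃ ε : ℝ, 0 < ε ∧ ε < 1 ∧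
    ∀ z : E, ‖z‖ < 1 → ∀ ξ : E, ‖ξ‖ < ε → z + btA z ξ ∈ btQ K z := by
  have hK' : (1 - 1 / K) > 0 := by
    rw [gt_iff_lt, sub_pos, div_lt_one (by linarith)]; exact hK
  obtain ⟨ε, h0, h1, h2⟩ : ∃ ε : ℝ, 0 < ε ∧ ε < 1 ∧ ε ^ 2 < (1 - 1 / K) * (1 - ε) ^ 2 := by
    have ht : Tendsto (fun ε : ℝ => (1 - 1 / K) * (1 - ε) ^ 2 - ε ^ 2) (𝓝[>] 0)
        (𝓝 ((1 - 1 / K) * (1 - 0) ^ 2 - 0 ^ 2)) := by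
      apply Tendsto.mono_left _ nhdsWithin_le_nhds
      apply Continuous.tendsto
      fun_prop
    have e1 := ht.eventually (lt_mem_nhds (a := 0) (by simpa using hK'))
    have e2 : ∀ᶠ ε : ℝ in 𝓝[>] 0, ε ∈ Set.Ioo (0 : ℝ) 1 := Ioo_mem_nhdsGT one_pos
    obtain ⟨ε, a, b⟩ := (e1.and e2).exists
    exact ⟨ε, b.1, b.2, by linarith⟩
  refine ⟨ε, h0, h1, fun z hz ξ hξ => ?_⟩
  have wz := bt_wt_pos hz
  have hin : ‖(inner ℂ z ξ : ℂ)‖ ≤ ε := by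
    refine (norm_inner_le_norm z ξ).trans ?_
    nlinarith [norm_nonneg z, norm_nonneg ξ]
  have hlow : 1 - ε ≤ ‖1 - (inner ℂ z ξ : ℂ)‖ := by
    have := norm_sub_norm_le (1 : ℂ) (inner ℂ z ξ)
    simp at this
    linarith
  have hw := bt_wt_btA z ξ hz
  have hi := bt_inner_btA z ξ hz
  set t := ‖1 - (inner ℂ z ξ : ℂ)‖
  have key : ‖ξ‖ ^ 2 < (1 - 1 / K) * t ^ 2 := by
    calc ‖ξ‖ ^ 2 ≤ ε ^ 2 := by gcongr
      _ < _ := h2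
      _ ≤ _ := by gcongr
  have key2 : t ^ 2 < K * (t ^ 2 - ‖ξ‖ ^ 2) := by
    have : K * ‖ξ‖ ^ 2 < K * ((1 - 1 / K) * t ^ 2) := by gcongr
    have e : K * ((1 - 1 / K) * t ^ 2) = K * t ^ 2 - t ^ 2 := by field_simp
    nlinarith
  have hpos : 0 < 1 - ‖z + btA z ξ‖ ^ 2 := by
    rw [hw]
    have : 0 < t ^ 2 - ‖ξ‖ ^ 2 := by
      have : 0 < K * (t ^ 2 - ‖ξ‖ ^ 2) := lt_of_le_of_lt (sq_nonneg _) key2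
      exact pos_of_mul_pos_right this (by linarith)
    positivity
  refine ⟨by nlinarith [norm_nonneg (z + btA z ξ)], ?_⟩
  rw [hi, hw, mul_pow]
  have : (1 - ‖z‖ ^ 2) ^ 2 * t ^ 2 < (1 - ‖z‖ ^ 2) ^ 2 * (K * (t ^ 2 - ‖ξ‖ ^ 2)) := by gcongr
  nlinarith

lemma bt_Q_sub {K : ℝ} {z ξ : E} (hz : ‖z‖ < 1) (h : z + btA z ξ ∈ btQ K z) : ‖ξ‖ < 2 * K := by
  have wz := bt_wt_pos hz
  have hK := bt_Q_Kpos hz h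
  have h1 := bt_Q_comp hz h
  have h2 := h.2
  have h3 := bt_wt_pos h.1
  rw [bt_inner_btA z ξ hz] at h2
  rw [bt_wt_btA z ξ hz] at h3
  set t := ‖1 - (inner ℂ z ξ : ℂ)‖
  have h5 : ‖ξ‖ ^ 2 < t ^ 2 := by
    by_contra hh
    push Not at hh
    nlinarith
  have h4 : ((1 - ‖z‖ ^ 2) * t) ^ 2 < (2 * K * (1 - ‖z‖ ^ 2)) ^ 2 := by
    have : K * ((1 - ‖z‖ ^ 2) * (1 - ‖z + btA z ξ‖ ^ 2)) ≤
      K * ((1 - ‖z‖ ^ 2) * (4 * K * (1 - ‖z‖ ^ 2))) := by gcongr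
    nlinarith
  have h6 : (1 - ‖z‖ ^ 2) * t < 2 * K * (1 - ‖z‖ ^ 2) := lt_of_pow_lt_pow_left₀ 2 (by positivity) h4
  have h7 : t < 2 * K := by
    by_contra hh
    push Not at hh
    nlinarith
  exact (lt_of_pow_lt_pow_left₀ 2 (norm_nonneg _) h5).trans h7

lemma btA_det [FiniteDimensional ℂ E] (z : E) (hz : ‖z‖ < 1) :
    LinearMap.det ((btA z).restrictScalars ℝ) = (1 - ‖z‖ ^ 2) ^ (Module.finrank ℂ E + 1) := by
  have hs := Real.sq_sqrt (bt_wt_pos hz).le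
  have hs0 := Real.sqrt_nonneg (1 - ‖z‖ ^ 2)
  rw [LinearMap.det_restrictScalars, btA, LinearMap.det_smul, LinearMap.transvection.det]
  set s := √(1 - ‖z‖ ^ 2)
  have e : (1 : ℂ) + ((innerSL ℂ z).toLinearMap) (-((1 / (1 + s) : ℝ) : ℂ) • z) = (s : ℂ) := by
    have : (1 - 1 / (1 + s) * ‖z‖ ^ 2) = s := by
      have : (1 + s) ≠ 0 := by positivity
      field_simp
      nlinarith
    conv_rhs => rw [← this]
    simp only [ContinuousLinearMap.coe_coe, innerSL_apply_apply, inner_smul_right,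
      inner_self_eq_norm_sq_to_K]
    push_cast
    simp
    ring
  rw [e, ← pow_succ, Algebra.norm_complex_apply, Complex.normSq_eq_norm_sq, norm_pow,
    Complex.norm_real, Real.norm_of_nonneg hs0, ← pow_mul, mul_comm, pow_mul, hs]

end geom


lemma bt_circle_submean {p : ℝ} (hp : 0 < p) {g : ℂ → ℂ}
    (hg : AnalyticOnNhd ℂ g (Metric.closedBall 0 1)) :
    ‖g 0‖ ^ p ≤ Real.circleAverage (fun z => ‖g z‖ ^ p) 0 1 := by
  by_cases h0 : g 0 = 0
  · rw [h0, norm_zero, Real.zero_rpow hp.ne']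
    apply Real.circleAverage_nonneg_of_nonneg
    intro x hx
    positivity
  have ha : 0 < ‖g 0‖ := norm_pos_iff.2 h0
  have hg' : AnalyticOnNhd ℂ g (Metric.closedBall 0 |(1:ℝ)|) := by simpa using hg
  have hJ := hg'.circleAverage_log_norm one_ne_zero h0
  have hJ2 : Real.log ‖g 0‖ ≤ Real.circleAverage (fun z => Real.log ‖g z‖) 0 1 := by
    rw [hJ]
    have : 0 ≤ ∑ᶠ u, (MeromorphicOn.divisor g (Metric.closedBall 0 |(1:ℝ)|)) u *
        Real.log (1 * ‖0 - u‖⁻¹) := by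
      apply finsum_nonneg
      intro u
      by_cases hu : u ∈ Metric.closedBall (0 : ℂ) |(1:ℝ)|
      · apply mul_nonneg
        · have := MeromorphicOn.AnalyticOnNhd.divisor_nonneg hg'
          exact_mod_cast this u
        · rw [one_mul, zero_sub, norm_neg, Real.log_inv]
          have : ‖u‖ ≤ 1 := by simpa using hu
          have := Real.log_nonpos (norm_nonneg u) this
          linarith
      · rw [Function.locallyFinsuppWithin.apply_eq_zero_of_notMem _ hu]; simp
    linarith
  set a := ‖g 0‖
  have hci : CircleIntegrable (fun z => Real.log ‖g z‖) 0 1 := by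
    apply MeromorphicOn.circleIntegrable_log_norm
    intro x hx
    exact (hg' x (Metric.sphere_subset_closedBall hx)).meromorphicAt
  have hcont : ContinuousOn (fun z => ‖g z‖ ^ p) (Metric.sphere 0 |(1:ℝ)|) := by
    apply ContinuousOn.rpow_const
    · exact (hg'.continuousOn.mono Metric.sphere_subset_closedBall).norm
    · intro x hx
      right; exact hp.le
  have hcp : CircleIntegrable (fun z => ‖g z‖ ^ p) 0 1 := hcont.circleIntegrable'
  -- modified function
  let F : ℂ → ℝ := fun z => if g z = 0 then Real.log a - 1 / p else Real.log ‖g z‖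
  have hF : (fun z => Real.log ‖g z‖) =ᶠ[codiscreteWithin (Metric.sphere 0 |(1:ℝ)|)] F := by
    have h1 := hg'.preimage_zero_mem_codiscreteWithin h0 (by simp)
      (Metric.isConnected_closedBall (by simp))
    have h2 := codiscreteWithin_mono (Metric.sphere_subset_closedBall (x := (0:ℂ)) (ε := |(1:ℝ)|)) h1
    filter_upwards [h2] with x hx
    simp at hx
    simp [F, hx]
  rw [Real.circleAverage_congr_codiscreteWithin hF one_ne_zero] at hJ2
  have hciF : CircleIntegrable F 0 1 := (circleIntegrable_congr_codiscreteWithin hF).1 hci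
  have hle : ∀ z, F z ≤ (Real.log a - 1 / p) + (1 / (p * a ^ p)) * ‖g z‖ ^ p := by
    intro z
    by_cases hz : g z = 0
    · simp [F, hz, Real.zero_rpow hp.ne']
    · have hz' : 0 < ‖g z‖ := norm_pos_iff.2 hz
      simp only [F, hz, if_false]
      have := Real.log_le_sub_one_of_pos (x := ‖g z‖ ^ p / a ^ p) (by positivity)
      rw [Real.log_div (by positivity) (by positivity), Real.log_rpow hz', Real.log_rpow ha] at this
      have e : (1 / (p * a ^ p)) * ‖g z‖ ^ p = (‖g z‖ ^ p / a ^ p) / p := by field_simp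
      rw [e]
      have h3 : Real.log ‖g z‖ = (p * Real.log ‖g z‖) / p := by field_simp
      rw [h3]
      have h4 : (Real.log a - 1 / p) + ‖g z‖ ^ p / a ^ p / p
        = (p * Real.log a - 1 + ‖g z‖ ^ p / a ^ p) / p := by field_simp
      rw [h4]
      gcongr
      linarith
  have hfin : Real.circleAverage F 0 1 ≤ (Real.log a - 1 / p) +
      (1 / (p * a ^ p)) * Real.circleAverage (fun z => ‖g z‖ ^ p) 0 1 := by
    have hc1 : CircleIntegrable (fun z => (1 / (p * a ^ p)) * ‖g z‖ ^ p) 0 1 := by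
      have := hcp.const_fun_smul (a := 1 / (p * a ^ p))
      simpa using this
    have hc2 : CircleIntegrable (fun _ : ℂ => (Real.log a - 1 / p)) 0 1 :=
      circleIntegrable_const _ _ _
    have := Real.circleAverage_mono hciF (hc2.add hc1) (fun x _ => hle x)
    rw [Real.circleAverage_add hc2 hc1] at this
    have e2 : Real.circleAverage (fun z => (1 / (p * a ^ p)) * ‖g z‖ ^ p) 0 1
       = (1 / (p * a ^ p)) * Real.circleAverage (fun z => ‖g z‖ ^ p) 0 1 := by
      have := Real.circleAverage_fun_smul (a := 1 / (p * a ^ p)) (f := fun z => ‖g z‖ ^ p) (c := 0) (R := 1)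
      simpa using this
    rw [e2, Real.circleAverage_const] at this
    exact this
  have h5 : 1 / p ≤ (1 / (p * a ^ p)) * Real.circleAverage (fun z => ‖g z‖ ^ p) 0 1 := by linarith
  have h6 : 0 < p * a ^ p := by positivity
  rw [one_div_mul_eq_div, le_div_iff₀ h6] at h5
  calc a ^ p = 1 / p * (p * a ^ p) := by field_simp
    _ ≤ _ := h5

lemma bt_circle_submean_enn {p : ℝ} (hp : 0 < p) {g : ℂ → ℂ}
    (hg : AnalyticOnNhd ℂ g (Metric.closedBall 0 1)) :
    ENNReal.ofReal (2 * Real.pi) * ‖g 0‖ₑ ^ p ≤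
      ∫⁻ θ in Set.Ioc 0 (2 * Real.pi), ‖g (circleMap 0 1 θ)‖ₑ ^ p := by
  have h := bt_circle_submean hp hg
  have hcont : ContinuousOn (fun z => ‖g z‖ ^ p) (Metric.sphere 0 |(1:ℝ)|) := by
    apply ContinuousOn.rpow_const
    · exact (hg.continuousOn.mono (by simpa using Metric.sphere_subset_closedBall)).norm
    · intro x hx
      right; exact hp.le
  have hcp : CircleIntegrable (fun z => ‖g z‖ ^ p) 0 1 := hcont.circleIntegrable'
  rw [Real.circleAverage, intervalIntegral.integral_of_le (by positivity), smul_eq_mul,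
    ← div_eq_inv_mul, le_div_iff₀ (by positivity), mul_comm] at h
  have hint : IntegrableOn (fun θ => ‖g (circleMap 0 1 θ)‖ ^ p) (Set.Ioc 0 (2 * Real.pi)) :=
    (intervalIntegrable_iff_integrableOn_Ioc_of_le (by positivity)).1 hcp
  have e : ∀ x : ℂ, ‖x‖ₑ ^ p = ENNReal.ofReal (‖x‖ ^ p) := fun x => by
    rw [← ofReal_norm, ENNReal.ofReal_rpow_of_nonneg (norm_nonneg _) hp.le]
  simp_rw [e]
  rw [← ENNReal.ofReal_mul (by positivity),
    ← ofReal_integral_eq_lintegral_ofReal hint (ae_of_all _ fun _ => by positivity)]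
  exact ENNReal.ofReal_le_ofReal h

section sub
variable {E : Type*} [NormedAddCommGroup E] [InnerProductSpace ℂ E] [FiniteDimensional ℂ E]
  [MeasurableSpace E] [BorelSpace E] (μ : Measure E) [μ.IsAddHaarMeasure]

lemma bt_rot (c : ℂ) (hc : ‖c‖ = 1) (F : E → ℝ≥0∞) (hF : Measurable F) :
    ∫⁻ x, F (c • x) ∂μ = ∫⁻ x, F x ∂μ := by
  let f : E →ₗ[ℝ] E := (c • (LinearMap.id : E →ₗ[ℂ] E)).restrictScalars ℝ
  have hdet : |(LinearMap.det f)⁻¹| = 1 := by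
    rw [LinearMap.det_restrictScalars, LinearMap.det_smul, LinearMap.det_id, mul_one,
      Algebra.norm_complex_apply, Complex.normSq_eq_norm_sq, norm_pow, hc]
    simp
  have hd : LinearMap.det f ≠ 0 := by
    intro h; rw [h] at hdet; simp at hdet
  have := Measure.map_linearMap_addHaar_eq_smul_addHaar μ hd
  rw [hdet, ENNReal.ofReal_one, one_smul] at this
  have hfm : Measurable f := by
    have : Continuous f := LinearMap.continuous_of_finiteDimensional f
    exact this.measurable
  conv_rhs => rw [← this, lintegral_map hF hfm]
  rfl

lemma bt_ball_submean {p : ℝ} (hp : 0 < p) {ε : ℝ} {H : E → ℂ}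
    (hH : DifferentiableOn ℂ H (Metric.ball 0 ε)) :
    μ (Metric.ball 0 ε) * ‖H 0‖ₑ ^ p ≤ ∫⁻ x in Metric.ball 0 ε, ‖H x‖ₑ ^ p ∂μ := by
  have hpi : ENNReal.ofReal (2 * Real.pi) ≠ 0 := by
    simp [Real.pi_pos]
  let F : E → ℝ≥0∞ := (Metric.ball 0 ε).indicator (fun x => ‖H x‖ₑ ^ p)
  have hF : Measurable F := by
    have h1 : ContinuousOn (fun x => ‖H x‖ₑ ^ p) (Metric.ball 0 ε) :=
      (ENNReal.continuous_rpow_const.comp continuous_enorm).comp_continuousOn hH.continuousOn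
    have : ContinuousOn F (Metric.ball 0 ε) := h1.congr (fun x hx => by simp [F, hx])
    exact h1.measurable_piecewise continuousOn_const measurableSet_ball
  have hcirc : ∀ x ∈ Metric.ball (0 : E) ε, ENNReal.ofReal (2 * Real.pi) * ‖H 0‖ₑ ^ p ≤
      ∫⁻ θ in Set.Ioc 0 (2 * Real.pi), F (circleMap 0 1 θ • x) := by
    intro x hx
    have hx' : ‖x‖ < ε := by simpa using hx
    have hg : AnalyticOnNhd ℂ (fun ζ : ℂ => H (ζ • x)) (Metric.closedBall 0 1) := by
      have ho : IsOpen {ζ : ℂ | ζ • x ∈ Metric.ball (0 : E) ε} :=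
        Metric.isOpen_ball.preimage (by fun_prop)
      have hd : DifferentiableOn ℂ (fun ζ : ℂ => H (ζ • x)) {ζ : ℂ | ζ • x ∈ Metric.ball (0 : E) ε} :=
        hH.comp (by fun_prop) (fun ζ hζ => hζ)
      refine (hd.analyticOnNhd ho).mono ?_
      intro ζ hζ
      have : ‖ζ‖ ≤ 1 := by simpa using hζ
      simp only [Set.mem_ofPred_eq, mem_ball_zero_iff, norm_smul]
      nlinarith [norm_nonneg x]
    have := bt_circle_submean_enn hp hg
    simp only [zero_smul] at this
    refine this.trans (le_of_eq ?_)
    apply lintegral_congr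
    intro θ
    have : circleMap 0 1 θ • x ∈ Metric.ball (0 : E) ε := by
      simp [norm_smul, hx']
    simp only [F, Set.indicator_of_mem this]
  have h1 : μ (Metric.ball 0 ε) * (ENNReal.ofReal (2 * Real.pi) * ‖H 0‖ₑ ^ p) ≤
      ENNReal.ofReal (2 * Real.pi) * ∫⁻ x, F x ∂μ := by
    calc μ (Metric.ball 0 ε) * (ENNReal.ofReal (2 * Real.pi) * ‖H 0‖ₑ ^ p)
        = ∫⁻ x in Metric.ball 0 ε, (ENNReal.ofReal (2 * Real.pi) * ‖H 0‖ₑ ^ p) ∂μ := by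
          rw [setLIntegral_const, mul_comm]
      _ ≤ ∫⁻ x in Metric.ball 0 ε,
            (∫⁻ θ in Set.Ioc 0 (2 * Real.pi), F (circleMap 0 1 θ • x)) ∂μ := by
          apply setLIntegral_mono' measurableSet_ball
          exact hcirc
      _ ≤ ∫⁻ x, (∫⁻ θ in Set.Ioc 0 (2 * Real.pi), F (circleMap 0 1 θ • x)) ∂μ :=
          setLIntegral_le_lintegral _ _
      _ = ∫⁻ θ in Set.Ioc 0 (2 * Real.pi), ∫⁻ x, F (circleMap 0 1 θ • x) ∂μ := by
          apply lintegral_lintegral_swap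
          apply Measurable.aemeasurable
          have : Measurable (fun q : E × ℝ => circleMap 0 1 q.2 • q.1) := by
            apply Continuous.measurable
            fun_prop
          exact hF.comp this
      _ = ∫⁻ θ in Set.Ioc 0 (2 * Real.pi), ∫⁻ x, F x ∂μ := by
          apply lintegral_congr
          intro θ
          exact bt_rot μ _ (by simp) F hF
      _ = _ := by
          rw [setLIntegral_const, Real.volume_Ioc, sub_zero, mul_comm]
  rw [mul_left_comm, ENNReal.mul_le_mul_iff_right hpi ENNReal.ofReal_ne_top] at h1
  rw [← lintegral_indicator measurableSet_ball]
  exact h1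

lemma bt_affine (z : E) (hz : ‖z‖ < 1) (F : E → ℝ≥0∞) (hF : Measurable F) :
    ∫⁻ x, F x ∂μ = ENNReal.ofReal ((1 - ‖z‖ ^ 2) ^ (Module.finrank ℂ E + 1)) *
      ∫⁻ ξ, F (z + btA z ξ) ∂μ := by
  have hw := bt_wt_pos hz
  have hd : LinearMap.det ((btA z).restrictScalars ℝ) ≠ 0 := by
    rw [btA_det z hz]; positivity
  have := Measure.map_linearMap_addHaar_eq_smul_addHaar μ hd
  rw [btA_det z hz] at this
  have hfm : Measurable ((btA z).restrictScalars ℝ) := by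
    have : Continuous ((btA z).restrictScalars ℝ) := LinearMap.continuous_of_finiteDimensional _
    exact this.measurable
  have h1 : ∫⁻ ξ, F (z + btA z ξ) ∂μ = ∫⁻ y, F (z + y) ∂(Measure.map ((btA z).restrictScalars ℝ) μ) := by
    rw [lintegral_map (by fun_prop) hfm]
    rfl
  rw [h1, this, lintegral_smul_measure, lintegral_add_left_eq_self (fun y => F y) z, smul_eq_mul,
    ← mul_assoc, ← ENNReal.ofReal_mul (by positivity), abs_of_pos (by positivity),
    mul_inv_cancel₀ (by positivity)]
  simp

lemma bt_Q_meas (K : ℝ) (z : E) : MeasurableSet (btQ K z) := by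
  have : IsOpen (btQ K z) := (bt_Q_open K).preimage (f := fun u : E => (z, u)) (by fun_prop)
  exact this.measurableSet

/-- volume of Q -/
lemma bt_Q_vol (K : ℝ) (z : E) (hz : ‖z‖ < 1) :
    μ (btQ K z) ≤ ENNReal.ofReal ((1 - ‖z‖ ^ 2) ^ (Module.finrank ℂ E + 1)) *
      μ (Metric.ball 0 (2 * K)) := by
  rw [← lintegral_indicator_one (bt_Q_meas K z), bt_affine μ z hz _
    (measurable_one.indicator (bt_Q_meas K z)), ← lintegral_indicator_one measurableSet_ball]
  gcongr with ξ
  by_cases h : z + btA z ξ ∈ btQ K z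
  · have := bt_Q_sub hz h
    rw [Set.indicator_of_mem h, Set.indicator_of_mem (by simpa using this)]
    simp
  · rw [Set.indicator_of_notMem h]; simp

lemma bt_meas_ind {F : E → ℂ} {S : Set E} (hS : MeasurableSet S) (hF : ContinuousOn F S) (p : ℝ) :
    Measurable (S.indicator (fun x => ‖F x‖ₑ ^ p)) := by
  have h1 : ContinuousOn (fun x => ‖F x‖ₑ ^ p) S :=
      (ENNReal.continuous_rpow_const.comp continuous_enorm).comp_continuousOn hF
  exact h1.measurable_piecewise continuousOn_const hS

lemma bt_submean {p K : ℝ} (hp : 0 < p) (hK : 1 < K) : ∃ C : ℝ≥0∞, C ≠ ⊤ ∧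
    ∀ h : E → ℂ, DifferentiableOn ℂ h (Metric.ball 0 1) → ∀ z : E, ‖z‖ < 1 →
    ENNReal.ofReal ((1 - ‖z‖ ^ 2) ^ (Module.finrank ℂ E + 1)) * ‖h z‖ₑ ^ p ≤
      C * ∫⁻ u in btQ K z, ‖h u‖ₑ ^ p ∂μ := by
  obtain ⟨ε, h0, h1, hε⟩ := bt_exists_eps (E := E) hK
  have hm0 : μ (Metric.ball 0 ε) ≠ 0 := (Metric.measure_ball_pos μ _ h0).ne'
  refine ⟨(μ (Metric.ball 0 ε))⁻¹, by simpa using hm0, fun h hh z hz => ?_⟩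
  have hsub : btQ K z ⊆ Metric.ball 0 1 := fun u hu => by simpa using hu.1
  have hd : DifferentiableOn ℂ (fun ξ => h (z + btA z ξ)) (Metric.ball 0 ε) := by
    refine hh.comp ?_ ?_
    · have : Differentiable ℂ (LinearMap.toContinuousLinearMap (btA z)) :=
        ContinuousLinearMap.differentiable _
      exact (this.const_add z).differentiableOn
    · intro ξ hξ
      exact hsub (hε z hz ξ (by simpa using hξ))
  have hs := bt_ball_submean μ hp hd
  simp only [map_zero, add_zero] at hs
  have hmF : Measurable ((btQ K z).indicator (fun x => ‖h x‖ₑ ^ p)) :=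
    bt_meas_ind (bt_Q_meas K z) (hh.continuousOn.mono hsub) p
  rw [← lintegral_indicator (bt_Q_meas K z), bt_affine μ z hz _ hmF, mul_left_comm]
  gcongr
  rw [← ENNReal.div_eq_inv_mul, ENNReal.le_div_iff_mul_le (Or.inl hm0) (Or.inl measure_ball_lt_top.ne),
    mul_comm]
  refine hs.trans ?_
  rw [← lintegral_indicator measurableSet_ball]
  apply lintegral_mono
  intro ξ
  by_cases hξ : ξ ∈ Metric.ball 0 ε
  · simp only [Set.indicator_of_mem hξ]
    rw [Set.indicator_of_mem (hε z hz ξ (by simpa using hξ))]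
  · simp [Set.indicator_of_notMem hξ]

end sub


def btW {E : Type*} [NormedAddCommGroup E] (β : ℝ) (z : E) : ℝ≥0∞ :=
  ENNReal.ofReal ((1 - ‖z‖ ^ 2) ^ β)

lemma bt_rpow_comp {a b L β : ℝ} (ha : 0 < a) (hb : 0 < b) (h1 : a ≤ L * b) (h2 : b ≤ L * a) :
    a ^ β ≤ L ^ |β| * b ^ β := by
  have hL : 0 < L := by
    by_contra h
    push Not at h
    nlinarith
  rcases le_total 0 β with h | h
  · rw [abs_of_nonneg h, ← Real.mul_rpow hL.le hb.le]
    exact Real.rpow_le_rpow ha.le h1 h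
  · rw [abs_of_nonpos h]
    have : (L * a) ^ β ≤ b ^ β := Real.rpow_le_rpow_of_nonpos hb h2 h
    rw [Real.mul_rpow hL.le ha.le] at this
    rw [Real.rpow_neg hL.le]
    have hLp : 0 < L ^ β := by positivity
    rw [← div_eq_inv_mul, le_div_iff₀ hLp]
    linarith

section avg
variable {E : Type*} [NormedAddCommGroup E] [InnerProductSpace ℂ E] [FiniteDimensional ℂ E]
  [MeasurableSpace E] [BorelSpace E] (μ : Measure E) [μ.IsAddHaarMeasure]

lemma btW_meas (β : ℝ) : Measurable (btW β : E → ℝ≥0∞) := by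
  unfold btW
  fun_prop

lemma btW_add {z : E} (hz : ‖z‖ < 1) (β γ : ℝ) : btW β z * btW γ z = btW (β + γ) z := by
  have := bt_wt_pos hz
  unfold btW
  rw [← ENNReal.ofReal_mul (by positivity), Real.rpow_add this]

lemma btW_zero (z : E) : btW 0 z = 1 := by
  simp [btW]

lemma btW_ne_top (β : ℝ) (z : E) : btW β z ≠ ⊤ := ENNReal.ofReal_ne_top

lemma btW_ne_zero {z : E} (hz : ‖z‖ < 1) (β : ℝ) : btW β z ≠ 0 := by
  have := bt_wt_pos hz
  have : 0 < (1 - ‖z‖ ^ 2) ^ β := by positivity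
  simpa [btW] using this

lemma btW_rpow {z : E} (hz : ‖z‖ < 1) (β : ℝ) {p : ℝ} (hp : 0 ≤ p) :
    (btW β z) ^ p = btW (β * p) z := by
  have := bt_wt_pos hz
  unfold btW
  rw [ENNReal.ofReal_rpow_of_nonneg (by positivity) hp, ← Real.rpow_mul this.le]

lemma btW_nat (m : ℕ) (z : E) : btW (m : ℝ) z = ENNReal.ofReal ((1 - ‖z‖ ^ 2) ^ m) := by
  unfold btW
  rw [Real.rpow_natCast]

lemma btW_comp {K : ℝ} {z u : E} (hz : ‖z‖ < 1) (h : u ∈ btQ K z) (β : ℝ) :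
    btW β z ≤ ENNReal.ofReal ((4 * K) ^ |β|) * btW β u := by
  have hK := bt_Q_Kpos hz h
  unfold btW
  rw [← ENNReal.ofReal_mul (by positivity)]
  apply ENNReal.ofReal_le_ofReal
  exact bt_rpow_comp (bt_wt_pos hz) (bt_wt_pos h.1) (bt_Q_comp' hz h).le (bt_Q_comp hz h).le

/-- averaging operator -/
def btS (K : ℝ) (F : E → ℝ≥0∞) (z : E) : ℝ≥0∞ :=
  btW (-((Module.finrank ℂ E : ℝ) + 1)) z * ∫⁻ u in btQ K z, F u ∂μ

lemma btS_point {p K : ℝ} (hp : 0 < p) : ∃ C : ℝ≥0∞, C ≠ ⊤ ∧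
    ∀ h : E → ℂ, DifferentiableOn ℂ h (Metric.ball 0 1) → ∀ z : E, ‖z‖ < 1 → ∀ u ∈ btQ K z,
    ‖h u‖ₑ ^ p ≤ C * btS μ (512 * K) (fun x => ‖h x‖ₑ ^ p) z := by
  obtain ⟨C, hC, H⟩ := bt_submean (E := E) μ hp (K := 2) (by norm_num)
  set d := Module.finrank ℂ E with hd
  refine ⟨ENNReal.ofReal ((4 * K) ^ |(d : ℝ) + 1|) * C, by finiteness, fun h hh z hz u hu => ?_⟩
  have h1 := H h hh u hu.1
  rw [← btW_nat] at h1
  push_cast at h1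
  have h2 := btW_comp hz hu ((d : ℝ) + 1)
  have h3 : ∫⁻ v in btQ 2 u, ‖h v‖ₑ ^ p ∂μ ≤ ∫⁻ v in btQ (512 * K) z, ‖h v‖ₑ ^ p ∂μ := by
    apply lintegral_mono_set
    intro v hv
    have := bt_Q_trans hz hu hv
    rwa [show 256 * K * 2 = 512 * K by ring] at this
  calc ‖h u‖ₑ ^ p = btW (-((d : ℝ) + 1)) z * (btW ((d : ℝ) + 1) z * ‖h u‖ₑ ^ p) := by
        rw [← mul_assoc, btW_add hz, neg_add_cancel, btW_zero, one_mul]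
    _ ≤ btW (-((d : ℝ) + 1)) z * ((ENNReal.ofReal ((4 * K) ^ |(d : ℝ) + 1|) *
          btW ((d : ℝ) + 1) u) * ‖h u‖ₑ ^ p) := by gcongr
    _ = btW (-((d : ℝ) + 1)) z * (ENNReal.ofReal ((4 * K) ^ |(d : ℝ) + 1|) *
          (btW ((d : ℝ) + 1) u * ‖h u‖ₑ ^ p)) := by ring
    _ ≤ btW (-((d : ℝ) + 1)) z * (ENNReal.ofReal ((4 * K) ^ |(d : ℝ) + 1|) *
          (C * ∫⁻ v in btQ (512 * K) z, ‖h v‖ₑ ^ p ∂μ)) := by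
          gcongr _ * (_ * ?_)
          exact h1.trans (by gcongr)
    _ = _ := by
          unfold btS
          simp only [← hd]
          ring

lemma btS_int (K β : ℝ) : ∃ C : ℝ≥0∞, C ≠ ⊤ ∧
    ∀ F : E → ℝ≥0∞, Measurable F →
    ∫⁻ z in Metric.ball 0 1, btW β z * btS μ K F z ∂μ ≤
      C * ∫⁻ z in Metric.ball 0 1, btW β z * F z ∂μ := by
  set d := Module.finrank ℂ E with hd
  set e : ℝ := (d : ℝ) + 1 with he
  refine ⟨ENNReal.ofReal ((4 * K) ^ |β + -e|) * μ (Metric.ball 0 (2 * K)), ?_, fun F hF => ?_⟩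
  · have : μ (Metric.ball 0 (2 * K)) ≠ ⊤ := measure_ball_lt_top.ne
    finiteness
  let T : Set (E × E) := {x | ‖x.1‖ < 1 ∧ x.2 ∈ btQ K x.1}
  have hT : MeasurableSet T :=
    ((isOpen_lt (f := fun x : E × E => ‖x.1‖) (g := fun _ => 1) (by fun_prop)
      (by fun_prop)).inter (bt_Q_open K)).measurableSet
  let G : E → E → ℝ≥0∞ := fun z u => T.indicator (fun x => btW (β + -e) x.1 * F x.2) (z, u)
  have hG : Measurable (Function.uncurry G) := by
    have : Measurable (fun x : E × E => btW (β + -e) x.1 * F x.2) :=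
      ((btW_meas _).comp measurable_fst).mul (hF.comp measurable_snd)
    exact this.indicator hT
  have hL : ∫⁻ z in Metric.ball 0 1, btW β z * btS μ K F z ∂μ = ∫⁻ z, ∫⁻ u, G z u ∂μ ∂μ := by
    rw [← lintegral_indicator measurableSet_ball]
    apply lintegral_congr
    intro z
    by_cases hz : ‖z‖ < 1
    · rw [Set.indicator_of_mem (by simpa using hz)]
      unfold btS
      rw [← mul_assoc, btW_add hz, ← lintegral_indicator (bt_Q_meas K z),
        ← lintegral_const_mul _ (hF.indicator (bt_Q_meas K z))]
      apply lintegral_congr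
      intro u
      by_cases hu : u ∈ btQ K z
      · have : (z, u) ∈ T := ⟨hz, hu⟩
        simp only [G, Set.indicator_of_mem this, Set.indicator_of_mem hu]
        rfl
      · have : (z, u) ∉ T := fun h => hu h.2
        simp only [G, Set.indicator_of_notMem this, Set.indicator_of_notMem hu, mul_zero]
    · rw [Set.indicator_of_notMem (by simpa using hz)]
      symm
      rw [lintegral_eq_zero_iff' (hG.of_uncurry_left).aemeasurable]
      refine ae_of_all _ fun u => ?_
      have : (z, u) ∉ T := fun h => hz h.1
      simp only [G, Set.indicator_of_notMem this, Pi.zero_apply]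
  rw [hL, lintegral_lintegral_swap hG.aemeasurable, ← lintegral_indicator measurableSet_ball,
    ← lintegral_const_mul _ (Measurable.indicator (f := fun z => btW β z * F z) ((btW_meas β).mul hF)
      measurableSet_ball)]
  apply lintegral_mono
  intro u
  beta_reduce
  by_cases hu : ‖u‖ < 1
  · rw [Set.indicator_of_mem (by simpa using hu)]
    calc ∫⁻ z, G z u ∂μ ≤ ∫⁻ z, (btQ K u).indicator (fun _ =>
          ENNReal.ofReal ((4 * K) ^ |β + -e|) * btW (β + -e) u * F u) z ∂μ := by
          apply lintegral_mono
          intro z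
          by_cases h : (z, u) ∈ T
          · simp only [G, Set.indicator_of_mem h, Set.indicator_of_mem (bt_Q_symm h.1 h.2)]
            gcongr
            exact btW_comp h.1 h.2 _
          · simp only [G, Set.indicator_of_notMem h]
            exact zero_le
      _ = ENNReal.ofReal ((4 * K) ^ |β + -e|) * btW (β + -e) u * F u * μ (btQ K u) := by
          rw [lintegral_indicator (bt_Q_meas K u), setLIntegral_const]
      _ ≤ ENNReal.ofReal ((4 * K) ^ |β + -e|) * btW (β + -e) u * F u *
            (btW e u * μ (Metric.ball 0 (2 * K))) := by
          gcongr
          have := bt_Q_vol μ K u hu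
          rw [← btW_nat] at this
          push_cast at this
          exact this
      _ = ENNReal.ofReal ((4 * K) ^ |β + -e|) * μ (Metric.ball 0 (2 * K)) *
            ((btW (β + -e) u * btW e u) * F u) := by ring
      _ = _ := by rw [btW_add hu, neg_add_cancel_right]
  · have : ∀ z, (z, u) ∉ T := fun z h => hu h.2.1
    simp only [G, Set.indicator_of_notMem (this _)]
    simp

end avg


lemma bt_add_rpow {p δ : ℝ} (hp : 0 < p) (hδ : 0 < δ) (a b : ℝ≥0∞) :
    (a + b) ^ p ≤ ENNReal.ofReal ((1 + δ) ^ p) * a ^ p + ENNReal.ofReal ((1 + 1 / δ) ^ p) * b ^ p := by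
  rw [← ENNReal.ofReal_rpow_of_nonneg (by positivity) hp.le,
    ← ENNReal.ofReal_rpow_of_nonneg (by positivity) hp.le,
    ← ENNReal.mul_rpow_of_nonneg _ _ hp.le, ← ENNReal.mul_rpow_of_nonneg _ _ hp.le,
    ENNReal.ofReal_add zero_le_one hδ.le, ENNReal.ofReal_add zero_le_one (by positivity),
    ENNReal.ofReal_one, add_mul, add_mul, one_mul, one_mul]
  rcases le_total b (ENNReal.ofReal δ * a) with h | h
  · refine le_trans ?_ le_self_add
    gcongr
  · refine le_trans ?_ le_add_self
    rw [add_comm]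
    gcongr
    calc a = ENNReal.ofReal (1 / δ) * (ENNReal.ofReal δ * a) := by
          rw [← mul_assoc, ← ENNReal.ofReal_mul (by positivity), one_div_mul_cancel hδ.ne']
          simp
      _ ≤ _ := by gcongr

lemma bt_affine1 (f : ℝ → ℝ≥0∞) (hf : Measurable f) :
    ∫⁻ r, f (2 * r - 1) = ENNReal.ofReal (1 / 2) * ∫⁻ r, f r := by
  have h := Real.map_volume_mul_left (a := 2) (by norm_num)
  have h1 : ∫⁻ r, f (2 * r - 1) = ∫⁻ y, f (y - 1) ∂(Measure.map (2 * ·) (volume : Measure ℝ)) := by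
    rw [lintegral_map (by fun_prop) (by fun_prop)]
  rw [h1, h, lintegral_smul_measure, lintegral_sub_right_eq_self (fun y => f y) 1, smul_eq_mul]
  norm_num

lemma bt_absorb {θ : ℝ} (h0 : 0 ≤ θ) (h1 : θ < 1) {X D : ℝ≥0∞} (hX : X ≠ ⊤)
    (h : X ≤ ENNReal.ofReal θ * X + D) : X ≤ ENNReal.ofReal (1 / (1 - θ)) * D := by
  have e : X = ENNReal.ofReal θ * X + ENNReal.ofReal (1 - θ) * X := by
    rw [← add_mul, ← ENNReal.ofReal_add h0 (by linarith)]
    simp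
  have h2 : ENNReal.ofReal (1 - θ) * X ≤ D := by
    rw [e] at h
    rw [← e] at h
    have h3 : ENNReal.ofReal θ * X + ENNReal.ofReal (1 - θ) * X ≤ ENNReal.ofReal θ * X + D := by
      rw [← e]; exact h
    exact (ENNReal.add_le_add_iff_left (by finiteness)).1 h3
  calc X = ENNReal.ofReal (1 / (1 - θ)) * (ENNReal.ofReal (1 - θ) * X) := by
        have : 0 < 1 - θ := by linarith
        rw [← mul_assoc, ← ENNReal.ofReal_mul (by positivity), one_div_mul_cancel this.ne']
        simp
    _ ≤ _ := by gcongr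

lemma bt_hardy1 (m : ℕ) {β p : ℝ} (hβ : -1 < β) (hp : 0 < p) :
    ∃ ρ₀ : ℝ, 3 / 4 ≤ ρ₀ ∧ ρ₀ < 1 ∧ ∃ C : ℝ≥0∞, C ≠ ⊤ ∧ ∀ φ N : ℝ → ℝ≥0∞, Measurable φ →
      (∀ ρ < 1, ∃ B : ℝ≥0∞, B ≠ ⊤ ∧ ∀ r ∈ Set.Ioo 0 ρ, φ r ≤ B) →
      (∀ r ∈ Set.Ioc 0 ρ₀, φ r ≤ N r) →
      (∀ r ∈ Set.Ioo ρ₀ 1, φ r ≤ φ (2 * r - 1) + N r) →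
      ∫⁻ r in Set.Ioo 0 1, ENNReal.ofReal ((1 - r) ^ β * r ^ m) * φ r ^ p ≤
        C * ∫⁻ r in Set.Ioo 0 1, ENNReal.ofReal ((1 - r) ^ β * r ^ m) * N r ^ p := by
  obtain ⟨δ, hδ0, hδ1, hθ⟩ : ∃ δ : ℝ, 0 < δ ∧ δ < 1 / 2 ∧
      (1 + δ) ^ p * ((2 - δ) / (2 * (1 - δ))) ^ m * (2 : ℝ) ^ (-β) * (1 / 2) < 1 := by
    have hc : ContinuousAt (fun δ : ℝ =>
        (1 + δ) ^ p * ((2 - δ) / (2 * (1 - δ))) ^ m * (2 : ℝ) ^ (-β) * (1 / 2)) 0 := by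
      have h1 : ContinuousAt (fun δ : ℝ => (1 + δ) ^ p) 0 :=
        ContinuousAt.rpow_const (by fun_prop) (Or.inr hp.le)
      have h2 : ContinuousAt (fun δ : ℝ => ((2 - δ) / (2 * (1 - δ))) ^ m) 0 := by
        apply ContinuousAt.pow
        apply ContinuousAt.div (by fun_prop) (by fun_prop)
        norm_num
      exact ((h1.mul h2).mul continuousAt_const).mul continuousAt_const
    have hv : (1 + (0:ℝ)) ^ p * ((2 - 0) / (2 * (1 - 0))) ^ m * (2 : ℝ) ^ (-β) * (1 / 2) < 1 := by
      have : (2 : ℝ) ^ (-β) < 2 ^ (1 : ℝ) := Real.rpow_lt_rpow_of_exponent_lt (by norm_num) (by linarith)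
      rw [Real.rpow_one] at this
      norm_num
      linarith
    have e1 := (hc.tendsto.mono_left (nhdsWithin_le_nhds (s := Set.Ioi 0))).eventually
      (gt_mem_nhds hv)
    have e2 : ∀ᶠ ε : ℝ in 𝓝[>] 0, ε ∈ Set.Ioo (0 : ℝ) (1 / 2) := Ioo_mem_nhdsGT (by norm_num)
    obtain ⟨δ, a, b⟩ := (e1.and e2).exists
    exact ⟨δ, b.1, b.2, a⟩
  set κ := ((2 - δ) / (2 * (1 - δ))) ^ m with hκ
  have hκ0 : 0 ≤ (2 - δ) / (2 * (1 - δ)) := div_nonneg (by linarith) (by linarith)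
  have hκ1 : 0 ≤ κ := by positivity
  set θ := (1 + δ) ^ p * κ * (2 : ℝ) ^ (-β) * (1 / 2) with hθd
  have hθ0 : 0 ≤ θ := by positivity
  refine ⟨1 - δ / 2, by linarith, by linarith,
    ENNReal.ofReal (1 / (1 - θ)) * ENNReal.ofReal ((1 + 1 / δ) ^ p), by finiteness, ?_⟩
  intro φ N hφ hB hN1 hN2
  set ω : ℝ → ℝ≥0∞ := fun r => ENNReal.ofReal ((1 - r) ^ β * r ^ m) with hω
  have hωm : Measurable ω := by fun_prop
  have hωφ : Measurable (fun r => ω r * φ r ^ p) := hωm.mul (hφ.pow_const p)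
  have main : ∀ ρ < 1, ∫⁻ r in Set.Ioo 0 ρ, ω r * φ r ^ p ≤
      ENNReal.ofReal (1 / (1 - θ)) * ENNReal.ofReal ((1 + 1 / δ) ^ p) *
        ∫⁻ r in Set.Ioo 0 1, ω r * N r ^ p := by
    intro ρ hρ
    rw [mul_assoc]
    apply bt_absorb hθ0 hθ
    · obtain ⟨B, hBt, hB'⟩ := hB ρ hρ
      have : ∫⁻ r in Set.Ioo 0 ρ, ω r * φ r ^ p ≤
          ∫⁻ r in Set.Ioo 0 ρ, ENNReal.ofReal (1 + (1 - ρ) ^ β) * B ^ p := by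
        apply setLIntegral_mono' measurableSet_Ioo
        intro r hr
        have : 0 < 1 - ρ := by linarith
        gcongr
        · apply ENNReal.ofReal_le_ofReal
          have h1 : (1 - r) ^ β ≤ 1 + (1 - ρ) ^ β := by
            rcases le_total 0 β with hb | hb
            · have := Real.rpow_le_one (x := 1 - r) (by linarith [hr.2]) (by linarith [hr.1]) hb
              have : 0 ≤ (1 - ρ) ^ β := by positivity
              linarith
            · have := Real.rpow_le_rpow_of_nonpos (x := 1 - ρ) (y := 1 - r) (by linarith)
                (by linarith [hr.2]) hb
              linarith
          have h2 : r ^ m ≤ 1 := pow_le_one₀ hr.1.le (by linarith [hr.2])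
          have h3 : 0 ≤ (1 - r) ^ β := Real.rpow_nonneg (by linarith [hr.2]) _
          have h4 : 0 ≤ r ^ m := pow_nonneg hr.1.le _
          nlinarith
        · exact hB' r hr
      refine ne_top_of_le_ne_top ?_ this
      rw [setLIntegral_const, Real.volume_Ioo]
      have : B ^ p ≠ ⊤ := ENNReal.rpow_ne_top_of_nonneg hp.le hBt
      finiteness
    · have hpt : ∀ r ∈ Set.Ioo 0 ρ, ω r * φ r ^ p ≤
          ENNReal.ofReal ((1 + δ) ^ p * κ * (2 : ℝ) ^ (-β)) *
            (Set.Ioo 0 ρ).indicator (fun s => ω s * φ s ^ p) (2 * r - 1)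
          + ENNReal.ofReal ((1 + 1 / δ) ^ p) * (ω r * N r ^ p) := by
        intro r hr
        by_cases hr0 : r ≤ 1 - δ / 2
        · refine le_trans ?_ le_add_self
          have h1 : φ r ^ p ≤ N r ^ p := by
            gcongr; exact hN1 r ⟨hr.1, hr0⟩
          have h2 : 1 ≤ ENNReal.ofReal ((1 + 1 / δ) ^ p) := by
            rw [← ENNReal.ofReal_one]
            apply ENNReal.ofReal_le_ofReal
            apply Real.one_le_rpow _ hp.le
            have : 0 < 1 / δ := by positivity
            linarith
          calc ω r * φ r ^ p ≤ 1 * (ω r * N r ^ p) := by rw [one_mul]; gcongr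
            _ ≤ _ := by gcongr
        · push Not at hr0
          have hs1 : 1 - δ < 2 * r - 1 := by linarith
          have hs : 2 * r - 1 ∈ Set.Ioo 0 ρ := ⟨by linarith, by linarith [hr.2]⟩
          rw [Set.indicator_of_mem hs]
          have h1 : φ r ^ p ≤ (φ (2 * r - 1) + N r) ^ p := by
            gcongr; exact hN2 r ⟨hr0, by linarith [hr.2]⟩
          have h2 := h1.trans (bt_add_rpow hp hδ0 _ _)
          have h3 : ω r ≤ ENNReal.ofReal (κ * (2 : ℝ) ^ (-β)) * ω (2 * r - 1) := by
            simp only [hω]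
            rw [← ENNReal.ofReal_mul (by positivity)]
            apply ENNReal.ofReal_le_ofReal
            have e1 : (1 - r) ^ β = (2 : ℝ) ^ (-β) * (1 - (2 * r - 1)) ^ β := by
              rw [show 1 - (2 * r - 1) = 2 * (1 - r) by ring,
                Real.mul_rpow (by norm_num) (by linarith [hr.2]), ← mul_assoc,
                ← Real.rpow_add (by norm_num)]
              simp
            have e2 : r ^ m ≤ κ * (2 * r - 1) ^ m := by
              rw [hκ, ← mul_pow]
              apply pow_le_pow_left₀ hr.1.le
              rw [div_mul_eq_mul_div, le_div_iff₀ (by linarith)]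
              nlinarith
            rw [e1]
            have : 0 ≤ (1 - (2 * r - 1)) ^ β := Real.rpow_nonneg (by linarith [hr.2]) _
            calc (2 : ℝ) ^ (-β) * (1 - (2 * r - 1)) ^ β * r ^ m
                ≤ (2 : ℝ) ^ (-β) * (1 - (2 * r - 1)) ^ β * (κ * (2 * r - 1) ^ m) := by gcongr
              _ = _ := by ring
          calc ω r * φ r ^ p ≤ ω r * (ENNReal.ofReal ((1 + δ) ^ p) * φ (2 * r - 1) ^ p
                + ENNReal.ofReal ((1 + 1 / δ) ^ p) * N r ^ p) := by gcongr
            _ = ω r * (ENNReal.ofReal ((1 + δ) ^ p) * φ (2 * r - 1) ^ p)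
                + ENNReal.ofReal ((1 + 1 / δ) ^ p) * (ω r * N r ^ p) := by ring
            _ ≤ (ENNReal.ofReal (κ * (2 : ℝ) ^ (-β)) * ω (2 * r - 1)) *
                  (ENNReal.ofReal ((1 + δ) ^ p) * φ (2 * r - 1) ^ p)
                + ENNReal.ofReal ((1 + 1 / δ) ^ p) * (ω r * N r ^ p) := by gcongr
            _ = _ := by
                rw [mul_assoc ((1 + δ) ^ p), ENNReal.ofReal_mul (p := (1 + δ) ^ p) (by positivity)]
                ring
      have hind : Measurable ((Set.Ioo 0 ρ).indicator (fun s => ω s * φ s ^ p)) :=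
        hωφ.indicator measurableSet_Ioo
      have hind2 : Measurable (fun r : ℝ =>
          (Set.Ioo 0 ρ).indicator (fun s => ω s * φ s ^ p) (2 * r - 1)) :=
        hind.comp (by fun_prop)
      calc ∫⁻ r in Set.Ioo 0 ρ, ω r * φ r ^ p
          ≤ ∫⁻ r in Set.Ioo 0 ρ, (ENNReal.ofReal ((1 + δ) ^ p * κ * (2 : ℝ) ^ (-β)) *
            (Set.Ioo 0 ρ).indicator (fun s => ω s * φ s ^ p) (2 * r - 1)
          + ENNReal.ofReal ((1 + 1 / δ) ^ p) * (ω r * N r ^ p)) :=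
            setLIntegral_mono' measurableSet_Ioo hpt
        _ = ENNReal.ofReal ((1 + δ) ^ p * κ * (2 : ℝ) ^ (-β)) * (∫⁻ r in Set.Ioo 0 ρ,
            (Set.Ioo 0 ρ).indicator (fun s => ω s * φ s ^ p) (2 * r - 1))
          + ENNReal.ofReal ((1 + 1 / δ) ^ p) * ∫⁻ r in Set.Ioo 0 ρ, ω r * N r ^ p := by
            rw [lintegral_add_left (hind2.const_mul _), lintegral_const_mul _ hind2,
              lintegral_const_mul' _ _ ENNReal.ofReal_ne_top]
        _ ≤ ENNReal.ofReal ((1 + δ) ^ p * κ * (2 : ℝ) ^ (-β)) * (∫⁻ r,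
            (Set.Ioo 0 ρ).indicator (fun s => ω s * φ s ^ p) (2 * r - 1))
          + ENNReal.ofReal ((1 + 1 / δ) ^ p) * ∫⁻ r in Set.Ioo 0 1, ω r * N r ^ p := by
            gcongr
            · exact Measure.restrict_le_self
        _ = _ := by
            rw [bt_affine1 _ hind, lintegral_indicator measurableSet_Ioo, ← mul_assoc,
              ← ENNReal.ofReal_mul (by positivity)]
  have hU : Set.Ioo (0 : ℝ) 1 = ⋃ j : ℕ, Set.Ioo (0 : ℝ) (1 - 1 / ((j : ℝ) + 1)) := by
    ext r
    simp only [Set.mem_iUnion, Set.mem_Ioo]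
    constructor
    · rintro ⟨h1, h2⟩
      obtain ⟨j, hj⟩ := exists_nat_one_div_lt (sub_pos.2 h2)
      exact ⟨j, h1, by linarith⟩
    · rintro ⟨j, h1, h2⟩
      refine ⟨h1, h2.trans_le ?_⟩
      have : 0 < 1 / ((j : ℝ) + 1) := by positivity
      linarith
  conv_lhs => rw [hU]
  rw [setLIntegral_iUnion_of_directed]
  · apply iSup_le
    intro j
    apply main
    have : 0 < 1 / ((j : ℝ) + 1) := by positivity
    linarith
  · apply Monotone.directed_le
    intro i j hij
    apply Set.Ioo_subset_Ioo_right
    have : (i : ℝ) ≤ j := by exact_mod_cast hij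
    gcongr


section polar
variable {E : Type*} [NormedAddCommGroup E] [InnerProductSpace ℂ E] [FiniteDimensional ℂ E]
  [MeasurableSpace E] [BorelSpace E] (μ : Measure E) [μ.IsAddHaarMeasure]

lemma bt_polar [Nontrivial E] : ∃ m : ℕ, ∀ F : E → ℝ≥0∞, Measurable F →
    ∫⁻ z in Metric.ball 0 1, F z ∂μ = ∫⁻ σ : Metric.sphere (0:E) 1,
      (∫⁻ r in Set.Ioo (0:ℝ) 1, ENNReal.ofReal (r ^ m) * F (((r : ℝ) : ℂ) • (σ : E))) ∂(μ.toSphere) := by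
  have : FiniteDimensional ℝ E := FiniteDimensional.complexToReal E
  refine ⟨Module.finrank ℝ E - 1, fun F hF => ?_⟩
  set G : E → ℝ≥0∞ := (Metric.ball 0 1).indicator F with hG
  have hGm : Measurable G := hF.indicator measurableSet_ball
  have hsm : Measurable fun y : Metric.sphere (0:E) 1 × Set.Ioi (0:ℝ) => G ((y.2 : ℝ) • (y.1 : E)) := by
    apply hGm.comp
    exact (by fun_prop : Continuous fun y : Metric.sphere (0:E) 1 × Set.Ioi (0:ℝ) => ((y.2 : ℝ) • (y.1 : E))).measurable
  rw [← lintegral_indicator measurableSet_ball]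
  have h1 : ∫⁻ z, G z ∂μ = ∫⁻ z in ({0}ᶜ : Set E), G z ∂μ := by
    rw [restrict_compl_singleton]
  rw [h1, ← lintegral_subtype_comap (measurableSet_singleton _).compl]
  have h2 : ∀ x : ({0}ᶜ : Set E), G x = (fun y : Metric.sphere (0:E) 1 × Set.Ioi (0:ℝ) => G ((y.2 : ℝ) • (y.1 : E))) (homeomorphUnitSphereProd E x) := by
    intro x
    have : ‖(x:E)‖ ≠ 0 := norm_ne_zero_iff.2 x.2
    simp [smul_smul, this]
  simp_rw [h2]
  rw [(Measure.measurePreserving_homeomorphUnitSphereProd μ).lintegral_comp hsm, lintegral_prod _ hsm.aemeasurable]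
  apply lintegral_congr
  intro σ
  have hr : Measurable fun r : ℝ => G (r • (σ : E)) := hGm.comp (by fun_prop)
  have hr' : Measurable fun r : Set.Ioi (0:ℝ) => G ((r:ℝ) • (σ : E)) := hr.comp measurable_subtype_coe
  dsimp only
  rw [Measure.volumeIoiPow, lintegral_withDensity_eq_lintegral_mul _ (by fun_prop) hr']
  have := lintegral_subtype_comap (μ := volume) (s := Set.Ioi (0:ℝ)) measurableSet_Ioi
    (fun r => ENNReal.ofReal (r ^ (Module.finrank ℝ E - 1)) * G (r • (σ : E)))
  simp only [Pi.mul_apply]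
  refine this.trans ?_
  rw [← lintegral_indicator measurableSet_Ioi, ← lintegral_indicator measurableSet_Ioo]
  apply lintegral_congr
  intro r
  have hσ : ‖(σ : E)‖ = 1 := by simpa using σ.2
  by_cases h0 : 0 < r
  · by_cases h1 : r < 1
    · have hb : r • (σ:E) ∈ Metric.ball (0:E) 1 := by simp [norm_smul, hσ, abs_of_pos h0, h1]
      rw [Set.indicator_of_mem (by exact h0), Set.indicator_of_mem (by exact ⟨h0, h1⟩), hG, Set.indicator_of_mem hb]
      congr 2
    · have hb : r • (σ:E) ∉ Metric.ball (0:E) 1 := by simp [norm_smul, hσ, abs_of_pos h0, not_lt.1 h1]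
      rw [Set.indicator_of_mem (by exact h0), Set.indicator_of_notMem (by simp [h1]), hG, Set.indicator_of_notMem hb, mul_zero]
  · rw [Set.indicator_of_notMem (by exact h0), Set.indicator_of_notMem (by simp [h0])]

end polar


section radial
variable {E : Type*} [NormedAddCommGroup E] [InnerProductSpace ℂ E] [FiniteDimensional ℂ E]
  [MeasurableSpace E] [BorelSpace E]

def btR (h : E → ℂ) (z : E) : ℂ := fderiv ℂ h z z

lemma bt_hasFD {h : E → ℂ} (hh : DifferentiableOn ℂ h (Metric.ball 0 1)) {z : E} (hz : ‖z‖ < 1) :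
    HasFDerivAt h (fderiv ℂ h z) z :=
  (hh.differentiableAt (Metric.isOpen_ball.mem_nhds (by simpa using hz))).hasFDerivAt

lemma bt_hasD {h : E → ℂ} (hh : DifferentiableOn ℂ h (Metric.ball 0 1)) {z : E} {ζ : ℂ}
    (hz : ‖ζ • z‖ < 1) :
    HasDerivAt (fun ζ : ℂ => h (ζ • z)) (fderiv ℂ h (ζ • z) z) ζ := by
  have h1 : HasDerivAt (fun ζ : ℂ => ζ • z) z ζ := by
    simpa using (hasDerivAt_id ζ).smul_const z
  exact (bt_hasFD hh hz).comp_hasDerivAt ζ h1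

lemma btR_diff {h : E → ℂ} (hh : DifferentiableOn ℂ h (Metric.ball 0 1)) :
    DifferentiableOn ℂ (btR h) (Metric.ball 0 1) := by
  intro z₀ hz₀
  have hz₀ : ‖z₀‖ < 1 := by simpa using hz₀
  apply DifferentiableAt.differentiableWithinAt
  set ρ := (1 - ‖z₀‖) / 4 with hρ
  have hρ0 : 0 < ρ := by rw [hρ]; linarith
  have hρ1 : ρ ≤ 1/4 := by rw [hρ]; linarith [norm_nonneg z₀]
  have hnorm : ∀ z ∈ Metric.ball z₀ ρ, ∀ ζ : ℂ, ‖ζ‖ ≤ ρ → ‖(1 + ζ) • z‖ < 1 - 2 * ρ := by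
    intro z hz ζ hζ
    have h1 : ‖z‖ < 1 - 3 * ρ := by
      have := norm_sub_norm_le z z₀
      rw [Metric.mem_ball, dist_eq_norm] at hz
      have : 4 * ρ = 1 - ‖z₀‖ := by rw [hρ]; ring
      linarith
    have h2 : ‖1 + ζ‖ ≤ 1 + ρ := (norm_add_le _ _).trans (by simpa using hζ)
    rw [norm_smul]
    calc ‖1 + ζ‖ * ‖z‖ ≤ (1 + ρ) * ‖z‖ := by gcongr
      _ < (1 + ρ) * (1 - 3 * ρ) := by gcongr
      _ ≤ _ := by nlinarith
  obtain ⟨M, hM⟩ := (isCompact_closedBall (0:E) (1 - ρ)).exists_bound_of_continuousOn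
    (hh.continuousOn.mono (Metric.closedBall_subset_ball (by linarith)))
  have hfd : ∀ w : E, ‖w‖ < 1 - 2 * ρ → ‖fderiv ℂ h w‖ ≤ 2 * M / ρ := by
    intro w hw
    have hsub : Metric.ball w ρ ⊆ Metric.closedBall 0 (1 - ρ) := by
      intro v hv
      rw [Metric.mem_ball, dist_eq_norm] at hv
      have := norm_sub_norm_le v w
      simp only [mem_closedBall_zero_iff]; linarith
    apply Complex.norm_fderiv_le_div_of_mapsTo_ball _ _ hρ0
    · exact hh.mono (hsub.trans (Metric.closedBall_subset_ball (by linarith)))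
    · intro v hv
      rw [Metric.mem_closedBall, dist_eq_norm]
      refine (norm_sub_le _ _).trans ?_
      have := hM v (hsub hv)
      have := hM w (hsub (Metric.mem_ball_self hρ0))
      linarith
  have hcn : ∀ θ, ‖circleMap 0 ρ θ‖ = ρ := by intro θ; simp [abs_of_pos hρ0]
  let F : E → ℝ → ℂ := fun z θ => deriv (circleMap 0 ρ) θ •
    (((circleMap 0 ρ θ - 0) ^ 2)⁻¹ • h ((1 + circleMap 0 ρ θ) • z))
  let F' : E → ℝ → E →L[ℂ] ℂ := fun z θ => deriv (circleMap 0 ρ) θ •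
    (((circleMap 0 ρ θ - 0) ^ 2)⁻¹ • ((1 + circleMap 0 ρ θ) • fderiv ℂ h ((1 + circleMap 0 ρ θ) • z)))
  have hrep : ∀ z ∈ Metric.ball z₀ ρ, btR h z = (2 * Real.pi * Complex.I : ℂ)⁻¹ • ∫ θ in (0:ℝ)..2 * Real.pi, F z θ := by
    intro z hz
    let U : Set ℂ := {ζ | ‖(1 + ζ) • z‖ < 1}
    have hU : IsOpen U := isOpen_lt (by fun_prop) continuous_const
    have hsub : Metric.closedBall 0 ρ ⊆ U := by
      intro ζ hζ
      have := hnorm z hz ζ (by simpa using hζ)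
      show ‖(1 + ζ) • z‖ < 1
      linarith
    have hD : ∀ ζ ∈ U, HasDerivAt (fun ζ : ℂ => h ((1 + ζ) • z)) (fderiv ℂ h ((1 + ζ) • z) z) ζ := by
      intro ζ hζ
      have := (bt_hasD hh (z := z) (ζ := 1 + ζ) hζ).comp_const_add 1 ζ
      exact this
    have := Complex.two_pi_I_inv_smul_circleIntegral_sub_sq_inv_smul_of_differentiable hU hsub
      (f := fun ζ : ℂ => h ((1 + ζ) • z)) (fun ζ hζ => (hD ζ hζ).differentiableAt.differentiableWithinAt) (Metric.mem_ball_self hρ0)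
    rw [(hD 0 (hsub (by simp [hρ0.le]))).deriv] at this
    simp only [add_zero, one_smul] at this
    rw [btR, ← this]
    rfl
  have hcont : ∀ z ∈ Metric.ball z₀ ρ, Continuous (F z) := by
    intro z hz
    have h1 : Continuous fun θ => h ((1 + circleMap 0 ρ θ) • z) := by
      apply hh.continuousOn.comp_continuous (by fun_prop)
      intro θ
      have := hnorm z hz _ (hcn θ).le
      simp only [Metric.mem_ball, dist_zero_right]
      linarith
    have h2 : Continuous fun θ => ((circleMap 0 ρ θ - 0) ^ 2)⁻¹ := by
      apply Continuous.inv₀ (by fun_prop)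
      intro θ
      have := hcn θ
      rw [sub_zero]
      apply pow_ne_zero
      rw [← norm_ne_zero_iff, this]
      exact hρ0.ne'
    have h3 : Continuous (deriv (circleMap 0 ρ)) := by
      have : deriv (circleMap 0 ρ) = fun θ => circleMap 0 ρ θ * Complex.I := by
        ext θ; simp [deriv_circleMap]
      rw [this]; fun_prop
    exact h3.smul (h2.smul h1)
  have key : HasFDerivAt (fun z => ∫ θ in (0:ℝ)..2 * Real.pi, F z θ) (∫ θ in (0:ℝ)..2 * Real.pi, F' z₀ θ) z₀ := by
    apply intervalIntegral.hasFDerivAt_integral_of_dominated_of_fderiv_le (Metric.ball_mem_nhds z₀ hρ0)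
      (bound := fun _ => ρ * (((ρ)^2)⁻¹ * (2 * (2 * M / ρ))))
    · filter_upwards [Metric.ball_mem_nhds z₀ hρ0] with z hz
      exact (hcont z hz).aestronglyMeasurable
    · exact (hcont z₀ (Metric.mem_ball_self hρ0)).intervalIntegrable _ _
    · apply Measurable.aestronglyMeasurable
      have m0 : Measurable fun θ => fderiv ℂ h ((1 + circleMap 0 ρ θ) • z₀) :=
        (measurable_fderiv ℂ h).comp (by fun_prop)
      have m1 : Measurable (deriv (circleMap 0 ρ)) := measurable_deriv _
      have m2 : Measurable fun θ => ((circleMap 0 ρ θ - 0) ^ 2)⁻¹ := by fun_prop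
      have m3 : Measurable fun θ => (1 + circleMap 0 ρ θ) := by fun_prop
      exact m1.smul (m2.smul (m3.smul m0))
    · refine ae_of_all _ fun θ _ z hz => ?_
      have h1 := hnorm z hz _ (hcn θ).le
      have h2 := hfd _ h1
      have h3 : ‖1 + circleMap 0 ρ θ‖ ≤ 2 := (norm_add_le _ _).trans (by rw [hcn]; simp; linarith)
      simp only [F', norm_smul, deriv_circleMap, norm_mul, hcn, norm_inv, norm_pow, sub_zero, Complex.norm_I, mul_one]
      gcongr
    · exact intervalIntegrable_const
    · refine ae_of_all _ fun θ _ z hz => ?_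
      have h1 := hnorm z hz _ (hcn θ).le
      have h2 := bt_hasFD hh (z := (1 + circleMap 0 ρ θ) • z) (by linarith)
      have h3 : HasFDerivAt (fun z : E => (1 + circleMap 0 ρ θ) • z) ((1 + circleMap 0 ρ θ) • ContinuousLinearMap.id ℂ E) z :=
        (hasFDerivAt_id z).const_smul _
      have h4 := (h2.comp z h3)
      have h5 : (fderiv ℂ h ((1 + circleMap 0 ρ θ) • z)).comp ((1 + circleMap 0 ρ θ) • ContinuousLinearMap.id ℂ E) = (1 + circleMap 0 ρ θ) • fderiv ℂ h ((1 + circleMap 0 ρ θ) • z) := by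
        ext; simp
      rw [h5] at h4
      exact (h4.const_smul (((circleMap 0 ρ θ - 0) ^ 2)⁻¹)).const_smul (deriv (circleMap 0 ρ) θ)
  have := (key.const_smul ((2 * Real.pi * Complex.I : ℂ)⁻¹)).differentiableAt
  refine this.congr_of_eventuallyEq ?_
  filter_upwards [Metric.ball_mem_nhds z₀ hρ0] with z hz using hrep z hz

end radial


section down
variable {E : Type*} [NormedAddCommGroup E] [InnerProductSpace ℂ E] [FiniteDimensional ℂ E]
  [MeasurableSpace E] [BorelSpace E]

lemma btR_smul (h : E → ℂ) (c : ℂ) (z : E) : btR h (c • z) = c * fderiv ℂ h (c • z) z := by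
  simp [btR]

lemma bt_far {h : E → ℂ} (hh : DifferentiableOn ℂ h (Metric.ball 0 1)) {σ : E} (hσ : ‖σ‖ = 1)
    {r : ℝ} (hr : 3/4 < r) (hr1 : r < 1) {X : ℝ≥0∞}
    (hX : ∀ t ∈ Set.Icc (2*r-1) r, ‖btR h ((t:ℂ) • σ)‖ₑ ≤ X) :
    ‖h ((r:ℂ) • σ)‖ₑ ≤ ‖h (((2*r-1:ℝ):ℂ) • σ)‖ₑ + ENNReal.ofReal (2*(1-r)) * X := by
  rcases eq_or_ne X ⊤ with rfl | hXt
  · rw [ENNReal.mul_top (by simpa using hr1)]; simp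
  set B := X.toReal with hB
  have hB0 : 0 ≤ B := ENNReal.toReal_nonneg
  have hXB : X = ENNReal.ofReal B := (ENNReal.ofReal_toReal hXt).symm
  have hn : ∀ t ∈ Set.Icc (2*r-1) r, ‖(t:ℂ) • σ‖ < 1 ∧ 1/2 < t := by
    intro t ht
    have : 1/2 < t := by linarith [ht.1]
    refine ⟨?_, this⟩
    rw [norm_smul, hσ, mul_one, Complex.norm_real, Real.norm_eq_abs, abs_of_pos (by linarith)]
    linarith [ht.2]
  have key := (convex_Icc (2*r-1) r).norm_image_sub_le_of_norm_hasDerivWithin_le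
    (f := fun t : ℝ => h ((t:ℂ) • σ)) (f' := fun t => fderiv ℂ h ((t:ℂ) • σ) σ) (C := 2 * B)
    (x := 2*r-1) (y := r) ?_ ?_ ⟨le_rfl, by linarith⟩ ⟨by linarith, le_rfl⟩
  · have h1 : ‖h ((r:ℂ) • σ)‖ ≤ ‖h (((2*r-1:ℝ):ℂ) • σ)‖ + 2*(1-r) * B := by
      have h2 := norm_sub_norm_le (h ((r:ℂ) • σ)) (h (((2*r-1:ℝ):ℂ) • σ))
      have h3 : ‖r - (2*r-1)‖ = 1 - r := by rw [Real.norm_eq_abs, abs_of_pos] <;> linarith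
      rw [h3] at key
      linarith
    rw [hXB, ← ENNReal.ofReal_mul (by linarith), ← ofReal_norm, ← ofReal_norm,
      ← ENNReal.ofReal_add (norm_nonneg _) (mul_nonneg (by linarith) hB0)]
    exact ENNReal.ofReal_le_ofReal h1
  · intro t ht
    exact ((bt_hasD hh (hn t ht).1).comp_ofReal).hasDerivWithinAt
  · intro t ht
    have h1 := hX t ht
    rw [hXB, ← ofReal_norm, ENNReal.ofReal_le_ofReal_iff hB0, btR_smul, norm_mul, Complex.norm_real,
      Real.norm_eq_abs, abs_of_pos (by linarith [(hn t ht).2])] at h1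
    nlinarith [(hn t ht).2, norm_nonneg (fderiv ℂ h ((t:ℂ) • σ) σ)]

lemma bt_near {h : E → ℂ} (hh : DifferentiableOn ℂ h (Metric.ball 0 1)) {z : E} (hz : ‖z‖ < 1)
    {X : ℝ≥0∞} (hX : ∀ ζ : ℂ, ‖ζ‖ = 1 → ‖btR h (ζ • z)‖ₑ ≤ X) :
    ‖h z‖ₑ ≤ ‖h 0‖ₑ + X := by
  rcases eq_or_ne X ⊤ with rfl | hXt
  · simp
  set B := X.toReal with hB
  have hB0 : 0 ≤ B := ENNReal.toReal_nonneg
  have hXB : X = ENNReal.ofReal B := (ENNReal.ofReal_toReal hXt).symm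
  let U : Set ℂ := {ζ | ‖ζ • z‖ < 1}
  have hU : IsOpen U := isOpen_lt (by fun_prop) continuous_const
  have hsub : Metric.closedBall 0 1 ⊆ U := by
    intro ζ hζ
    have hζ : ‖ζ‖ ≤ 1 := by simpa using hζ
    show ‖ζ • z‖ < 1
    rw [norm_smul]
    nlinarith [norm_nonneg z]
  set G : ℂ → ℂ := fun ζ => h (ζ • z) with hG
  have hD : ∀ ζ ∈ U, HasDerivAt G (fderiv ℂ h (ζ • z) z) ζ := fun ζ hζ => bt_hasD hh hζ
  have hGd : DifferentiableOn ℂ G U := fun ζ hζ => (hD ζ hζ).differentiableAt.differentiableWithinAt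
  have hG' : DifferentiableOn ℂ (deriv G) U := hGd.deriv hU
  have hmax : ∀ ζ ∈ Metric.closedBall (0:ℂ) 1, ‖deriv G ζ‖ ≤ B := by
    intro ζ hζ
    refine Complex.norm_le_of_forall_mem_frontier_norm_le (U := Metric.ball 0 1) Metric.isBounded_ball
      (hG'.diffContOnCl_ball hsub) ?_ (by rwa [closure_ball _ one_ne_zero])
    intro w hw
    rw [frontier_ball _ one_ne_zero] at hw
    have hw1 : ‖w‖ = 1 := by simpa using hw
    have h1 := hX w hw1
    rw [hXB, ← ofReal_norm, ENNReal.ofReal_le_ofReal_iff hB0, btR_smul, norm_mul, hw1, one_mul] at h1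
    rwa [(hD w (hsub (Metric.sphere_subset_closedBall hw))).deriv]
  have key := (convex_closedBall (0:ℂ) 1).norm_image_sub_le_of_norm_deriv_le
    (f := G) (C := B) (x := 0) (y := 1) (fun ζ hζ => (hD ζ (hsub hζ)).differentiableAt) hmax
    (by simp) (by simp)
  simp only [hG, one_smul, zero_smul, sub_zero, norm_one, mul_one] at key
  have h1 : ‖h z‖ ≤ ‖h 0‖ + B := by
    have h2 := norm_sub_norm_le (h z) (h 0)
    linarith
  rw [hXB, ← ofReal_norm, ← ofReal_norm, ← ENNReal.ofReal_add (norm_nonneg _) hB0]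
  exact ENNReal.ofReal_le_ofReal h1

lemma bt_far_mem {σ : E} (hσ : ‖σ‖ = 1) {r t : ℝ} (hr : 3/4 < r) (hr1 : r < 1)
    (ht : t ∈ Set.Icc (2*r-1) r) : (t:ℂ) • σ ∈ btQ 10 ((r:ℂ) • σ) := by
  have ht0 : 0 < t := by linarith [ht.1]
  have hnt : ‖(t:ℂ) • σ‖ = t := by
    rw [norm_smul, hσ, mul_one, Complex.norm_real, Real.norm_eq_abs, abs_of_pos ht0]
  have hnr : ‖(r:ℂ) • σ‖ = r := by
    rw [norm_smul, hσ, mul_one, Complex.norm_real, Real.norm_eq_abs, abs_of_pos (by linarith)]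
  refine ⟨by rw [hnt]; linarith [ht.2], ?_⟩
  rw [hnt, hnr, inner_smul_left, inner_smul_right, inner_self_eq_norm_sq_to_K, hσ]
  have : (1:ℂ) - (starRingEnd ℂ) (r:ℂ) * ((t:ℂ) * (((1:ℝ):ℂ))^2) = ((1 - r * t : ℝ) : ℂ) := by
    simp
  have h2 : ‖(1:ℂ) - (starRingEnd ℂ) (r:ℂ) * ((t:ℂ) * (((1:ℝ):ℂ))^2)‖ = 1 - r * t := by
    rw [this, Complex.norm_real, Real.norm_eq_abs, abs_of_pos]
    nlinarith [ht.2]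
  erw [h2]
  obtain ⟨h3, h4⟩ := ht
  have e1 : 0 < 1 - r := by linarith
  have e2 : 1 - r * t ≤ 3 * (1 - r) := by nlinarith
  have e3 : 0 ≤ 1 - r * t := by nlinarith
  have e4 : 7/4 * (1 - r) ≤ 1 - r^2 := by nlinarith
  have e5 : 3/2 * (1 - r) ≤ 1 - t^2 := by nlinarith
  have e6 : (7/4 * (1 - r)) * (3/2 * (1-r)) ≤ (1 - r^2) * (1 - t^2) := by gcongr; linarith
  have e7 : (1 - r*t)^2 ≤ (3 * (1-r))^2 := by gcongr
  nlinarith [mul_pos e1 e1]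

lemma bt_near_mem {z : E} {ρ : ℝ} (hρ : ρ < 1) (hz : ‖z‖ ≤ ρ) {ζ : ℂ} (hζ : ‖ζ‖ = 1) :
    ζ • z ∈ btQ (5 / (1 - ρ^2)^2) z := by
  have hn : ‖ζ • z‖ = ‖z‖ := by rw [norm_smul, hζ, one_mul]
  have h0 := norm_nonneg z
  refine ⟨by rw [hn]; linarith, ?_⟩
  rw [hn]
  have h1 : ‖1 - inner ℂ z (ζ • z)‖ ≤ 2 := by
    refine (norm_sub_le _ _).trans ?_
    have := norm_inner_le_norm (𝕜 := ℂ) z (ζ • z)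
    rw [hn] at this
    rw [norm_one]
    nlinarith
  have h2 : 0 < 1 - ρ^2 := by nlinarith
  have h3 : 1 - ρ^2 ≤ 1 - ‖z‖^2 := by nlinarith
  have h4 : (1-ρ^2)^2 ≤ (1 - ‖z‖^2) * (1 - ‖z‖^2) := by nlinarith
  calc ‖1 - inner ℂ z (ζ • z)‖^2 ≤ 2^2 := by gcongr
    _ < 5 := by norm_num
    _ = 5 / (1-ρ^2)^2 * (1-ρ^2)^2 := by field_simp
    _ ≤ _ := by gcongr

end down


section down2
variable {E : Type*} [NormedAddCommGroup E] [InnerProductSpace ℂ E] [FiniteDimensional ℂ E]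
  [MeasurableSpace E] [BorelSpace E] (μ : Measure E) [μ.IsAddHaarMeasure]

lemma btS_meas (K : ℝ) {F : E → ℝ≥0∞} (hF : Measurable F) : Measurable (btS μ K F) := by
  unfold btS
  refine (btW_meas _).mul ?_
  let T : Set (E × E) := {x | x.2 ∈ btQ K x.1}
  have hm : Measurable (T.indicator (fun x => F x.2)) :=
    (hF.comp measurable_snd).indicator (bt_Q_open K).measurableSet
  have := Measurable.lintegral_prod_right' (ν := μ) hm
  convert this using 2 with z
  rw [← lintegral_indicator (bt_Q_meas K z)]
  rfl

lemma btS_congr {K : ℝ} {F G : E → ℝ≥0∞} (z : E) (h : ∀ u, ‖u‖ < 1 → F u = G u) :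
    btS μ K F z = btS μ K G z := by
  unfold btS
  congr 1
  apply setLIntegral_congr_fun (bt_Q_meas K z)
  intro u hu
  exact h u hu.1

lemma btW_radial {σ : E} (hσ : ‖σ‖ = 1) {r : ℝ} (hr : r ∈ Set.Ioo (0:ℝ) 1) (β : ℝ) :
    btW β ((r:ℂ) • σ) ≤ ENNReal.ofReal (2 ^ |β|) * ENNReal.ofReal ((1 - r) ^ β) ∧
    ENNReal.ofReal ((1 - r) ^ β) ≤ ENNReal.ofReal (2 ^ |β|) * btW β ((r:ℂ) • σ) := by
  have hnr : ‖(r:ℂ) • σ‖ = r := by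
    rw [norm_smul, hσ, mul_one, Complex.norm_real, Real.norm_eq_abs, abs_of_pos hr.1]
  obtain ⟨h0, h1⟩ := hr
  unfold btW
  rw [hnr, ← ENNReal.ofReal_mul (by positivity), ← ENNReal.ofReal_mul (by positivity)]
  have a1 : 0 < 1 - r := by linarith
  have a2 : 0 < 1 - r^2 := by nlinarith
  constructor <;> apply ENNReal.ofReal_le_ofReal <;> apply bt_rpow_comp <;> nlinarith

lemma bt_int01 {β : ℝ} (hβ : -1 < β) :
    ∫⁻ r in Set.Ioo (0:ℝ) 1, ENNReal.ofReal ((1 - r) ^ β) ≠ ⊤ := by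
  have h1 : IntervalIntegrable (fun x : ℝ => (1 - x) ^ β) volume 0 1 := by
    have := (intervalIntegral.intervalIntegrable_rpow' (a := 0) (b := 1) hβ).comp_sub_left 1
    simpa using this.symm
  rw [intervalIntegrable_iff_integrableOn_Ioo_of_le zero_le_one] at h1
  exact h1.lintegral_lt_top.ne

lemma bt_W_int [Nontrivial E] {β : ℝ} (hβ : -1 < β) :
    ∫⁻ z in Metric.ball (0:E) 1, btW β z ∂μ ≠ ⊤ := by
  obtain ⟨m, hm⟩ := bt_polar μ
  rw [hm _ (btW_meas β)]
  refine ne_top_of_le_ne_top (b := ∫⁻ _ : Metric.sphere (0:E) 1, ENNReal.ofReal (2 ^ |β|) * (∫⁻ r in Set.Ioo (0:ℝ) 1, ENNReal.ofReal ((1 - r) ^ β)) ∂(μ.toSphere)) ?_ ?_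
  · have : FiniteDimensional ℝ E := FiniteDimensional.complexToReal E
    rw [lintegral_const]
    have := bt_int01 hβ
    finiteness
  · apply lintegral_mono
    intro σ
    have hσ : ‖(σ : E)‖ = 1 := by simp
    beta_reduce
    rw [← lintegral_const_mul _ (by fun_prop)]
    apply setLIntegral_mono' measurableSet_Ioo
    intro r hr
    calc _ ≤ 1 * btW β ((r:ℂ) • (σ:E)) := by
            gcongr
            rw [ENNReal.ofReal_le_one]
            exact pow_le_one₀ hr.1.le hr.2.le
      _ ≤ _ := by rw [one_mul]; exact (btW_radial hσ hr β).1

lemma bt_down [Nontrivial E] {β p : ℝ} (hβ : -1 < β) (hp : 0 < p) : ∃ C : ℝ≥0∞, C ≠ ⊤ ∧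
    ∀ h : E → ℂ, DifferentiableOn ℂ h (Metric.ball 0 1) →
      ∫⁻ z in Metric.ball 0 1, btW β z * ‖h z‖ₑ ^ p ∂μ ≤
        C * (‖h 0‖ₑ ^ p + ∫⁻ z in Metric.ball 0 1, btW (β + p) z * ‖btR h z‖ₑ ^ p ∂μ) := by
  obtain ⟨m, hm⟩ := bt_polar μ
  obtain ⟨ρ₀, hρ, hρ1, C₁, hC₁, H⟩ := bt_hardy1 m hβ hp
  set K := max 10 (5 / (1 - ρ₀^2)^2) with hK
  obtain ⟨C₂, hC₂, H₂⟩ := btS_point μ (K := K) hp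
  obtain ⟨C₃, hC₃, H₃⟩ := btS_int μ (512 * K) (β + p)
  have hI := bt_W_int μ hβ
  set I := ∫⁻ z in Metric.ball (0:E) 1, btW β z ∂μ
  set D := 2 + 1 / (1 - ρ₀) with hD
  have hρ' : 0 < 1 - ρ₀ := by linarith
  have hD0 : 0 < D := by positivity
  set A := ENNReal.ofReal (2 ^ |β|) with hA
  set A' := ENNReal.ofReal (2 ^ |β + p|) with hA'
  set c := ENNReal.ofReal ((1 + 1) ^ p) with hc
  set c₂ := ENNReal.ofReal (D ^ p) with hc₂
  -- total constants
  refine ⟨(A * C₁) * (c * A * I + (c * c₂ * C₂ * A') * C₃), by finiteness, fun h hh => ?_⟩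
  set Fp : E → ℝ≥0∞ := (Metric.ball 0 1).indicator (fun x => ‖btR h x‖ₑ ^ p) with hFp
  have hFpm : Measurable Fp := bt_meas_ind measurableSet_ball (btR_diff hh).continuousOn p
  have hFpe : ∀ u : E, ‖u‖ < 1 → ‖btR h u‖ₑ ^ p = Fp u := fun u hu => by
    rw [hFp, Set.indicator_of_mem (by simpa using hu)]
  set g : E → ℝ≥0∞ := (Metric.ball 0 1).indicator (fun x => ‖h x‖ₑ ^ (1:ℝ)) with hg
  have hgm : Measurable g := bt_meas_ind measurableSet_ball hh.continuousOn 1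
  have hge : ∀ u : E, ‖u‖ < 1 → g u = ‖h u‖ₑ := fun u hu => by
    rw [hg, Set.indicator_of_mem (by simpa using hu), ENNReal.rpow_one]
  set S : E → ℝ≥0∞ := btS μ (512 * K) Fp with hS
  have hSm : Measurable S := btS_meas μ _ hFpm
  have hpt : ∀ z : E, ‖z‖ < 1 → ∀ u ∈ btQ K z, ‖btR h u‖ₑ ≤ (C₂ * S z) ^ (1/p) := by
    intro z hz u hu
    rw [one_div, ENNReal.le_rpow_inv_iff hp, hS, ← btS_congr μ z hFpe]
    exact H₂ _ (btR_diff hh) z hz u hu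
  have step : ∀ σ : E, ‖σ‖ = 1 → 
      ∫⁻ r in Set.Ioo (0:ℝ) 1, ENNReal.ofReal (r ^ m) * (btW β ((r:ℂ) • σ) * g ((r:ℂ) • σ) ^ p) ≤
      (A * C₁) * ∫⁻ r in Set.Ioo (0:ℝ) 1, ENNReal.ofReal (r ^ m) * 
        (c * A * (‖h 0‖ₑ ^ p * btW β ((r:ℂ) • σ)) + (c * c₂ * C₂ * A') * (btW (β + p) ((r:ℂ) • σ) * S ((r:ℂ) • σ))) := by
    intro σ hσ
    have hnr : ∀ r : ℝ, 0 < r → ‖(r:ℂ) • σ‖ = r := fun r hr => by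
      rw [norm_smul, hσ, mul_one, Complex.norm_real, Real.norm_eq_abs, abs_of_pos hr]
    have h1 := H (fun r => g ((r:ℂ) • σ)) (fun r => ‖h 0‖ₑ + ENNReal.ofReal (D * (1 - r)) * (C₂ * S ((r:ℂ) • σ)) ^ (1/p))
      (hgm.comp (by fun_prop)) ?_ ?_ ?_
    · calc _ ≤ ∫⁻ r in Set.Ioo (0:ℝ) 1, A * (ENNReal.ofReal ((1 - r) ^ β * r ^ m) * g ((r:ℂ) • σ) ^ p) := by
            apply setLIntegral_mono' measurableSet_Ioo
            intro r hr
            have h2 := (btW_radial hσ hr β).1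
            have : 0 < 1 - r := by linarith [hr.2]
            rw [ENNReal.ofReal_mul (by positivity)]
            calc _ ≤ ENNReal.ofReal (r ^ m) * ((A * ENNReal.ofReal ((1 - r) ^ β)) * g ((r:ℂ) • σ) ^ p) := by gcongr
              _ = _ := by ring
        _ = A * ∫⁻ r in Set.Ioo (0:ℝ) 1, (ENNReal.ofReal ((1 - r) ^ β * r ^ m) * g ((r:ℂ) • σ) ^ p) := by
            rw [lintegral_const_mul]
            have : Measurable fun r : ℝ => g ((r:ℂ) • σ) := hgm.comp (by fun_prop)
            fun_prop
        _ ≤ A * (C₁ * _) := by gcongr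
        _ ≤ _ := by
            rw [mul_assoc]
            gcongr A * (C₁ * ?_)
            apply setLIntegral_mono' measurableSet_Ioo
            intro r hr
            have h2 := (btW_radial hσ hr β).2
            have h3 := (btW_radial hσ hr (β + p)).2
            have hr1 : 0 < 1 - r := by linarith [hr.2]
            have h4 := bt_add_rpow hp one_pos (‖h 0‖ₑ) (ENNReal.ofReal (D * (1 - r)) * (C₂ * S ((r:ℂ) • σ)) ^ (1/p))
            rw [ENNReal.mul_rpow_of_nonneg _ _ hp.le, ← ENNReal.rpow_mul, one_div_mul_cancel hp.ne', ENNReal.rpow_one,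
              ENNReal.ofReal_rpow_of_nonneg (by positivity) hp.le, Real.mul_rpow hD0.le hr1.le, ENNReal.ofReal_mul (p := D ^ p) (by positivity), div_one] at h4
            rw [mul_comm ((1 - r) ^ β), ENNReal.ofReal_mul (pow_nonneg hr.1.le m), mul_assoc]
            gcongr ENNReal.ofReal (r ^ m) * ?_
            have h5 : ENNReal.ofReal ((1 - r) ^ β) * ENNReal.ofReal ((1 - r) ^ p) = ENNReal.ofReal ((1 - r) ^ (β + p)) := by
              rw [← ENNReal.ofReal_mul (by positivity), Real.rpow_add hr1]
            calc _ ≤ ENNReal.ofReal ((1 - r) ^ β) * (c * ‖h 0‖ₑ ^ p + c * (c₂ * ENNReal.ofReal ((1 - r) ^ p) * (C₂ * S ((r:ℂ) • σ)))) := by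
                  gcongr
              _ = c * ENNReal.ofReal ((1 - r) ^ β) * ‖h 0‖ₑ ^ p + c * c₂ * C₂ * (ENNReal.ofReal ((1 - r) ^ β) * ENNReal.ofReal ((1 - r) ^ p)) * S ((r:ℂ) • σ) := by ring
              _ ≤ c * (A * btW β ((r:ℂ) • σ)) * ‖h 0‖ₑ ^ p + c * c₂ * C₂ * (A' * btW (β + p) ((r:ℂ) • σ)) * S ((r:ℂ) • σ) := by
                  rw [h5]; gcongr
              _ = _ := by ring
    · intro ρ hρ
      obtain ⟨B, hB⟩ := (isCompact_closedBall (0:E) ρ).exists_bound_of_continuousOn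
        (hh.continuousOn.mono (Metric.closedBall_subset_ball hρ))
      refine ⟨ENNReal.ofReal B, ENNReal.ofReal_ne_top, fun r hr => ?_⟩
      rw [hge _ (by rw [hnr r hr.1]; linarith [hr.2]), ← ofReal_norm]
      apply ENNReal.ofReal_le_ofReal
      apply hB
      rw [mem_closedBall_zero_iff, hnr r hr.1]
      exact hr.2.le
    · intro r hr
      have hn1 : ‖(r:ℂ) • σ‖ < 1 := by rw [hnr r hr.1]; linarith [hr.2]
      rw [hge _ hn1]
      have h2 := bt_near hh hn1 (X := (C₂ * S ((r:ℂ) • σ)) ^ (1/p)) (fun ζ hζ => hpt _ hn1 _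
        (bt_Q_mono (le_max_right _ _) hn1 (bt_near_mem hρ1 (by rw [hnr r hr.1]; exact hr.2) hζ)))
      refine h2.trans ?_
      gcongr
      refine le_mul_of_one_le_left' ?_
      rw [ENNReal.one_le_ofReal, hD]
      have : 1 ≤ 1 / (1 - ρ₀) * (1 - r) := by
        rw [one_div, inv_mul_eq_div, one_le_div hρ']
        linarith [hr.2]
      nlinarith [hr.2]
    · intro r hr
      have hr0 : 0 < r := by linarith [hr.1]
      have hn1 : ‖(r:ℂ) • σ‖ < 1 := by rw [hnr r hr0]; linarith [hr.2]
      have hn2 : ‖((2*r-1:ℝ):ℂ) • σ‖ < 1 := by rw [hnr _ (by linarith [hr.1])]; linarith [hr.2]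
      beta_reduce
      rw [hge _ hn1, hge _ hn2]
      have h2 := bt_far hh hσ (r := r) (by linarith [hr.1]) hr.2 (X := (C₂ * S ((r:ℂ) • σ)) ^ (1/p)) (fun t ht => hpt _ hn1 _
        (bt_Q_mono (le_max_left _ _) hn1 (bt_far_mem hσ (by linarith [hr.1]) hr.2 ht)))
      refine h2.trans ?_
      rw [← add_assoc]
      gcongr
      · exact le_self_add
      · linarith [hr.2]
      · rw [hD]; have : 0 ≤ 1 / (1 - ρ₀) := by positivity
        linarith
  have hWm := btW_meas (E := E) β
  have hWm' := btW_meas (E := E) (β + p)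
  calc ∫⁻ z in Metric.ball 0 1, btW β z * ‖h z‖ₑ ^ p ∂μ = ∫⁻ z in Metric.ball 0 1, btW β z * g z ^ p ∂μ := by
        apply setLIntegral_congr_fun measurableSet_ball
        intro z hz
        beta_reduce
        rw [hge z (by simpa using hz)]
    _ = _ := hm _ (by fun_prop)
    _ ≤ ∫⁻ σ : Metric.sphere (0:E) 1, (A * C₁) * (∫⁻ r in Set.Ioo (0:ℝ) 1, ENNReal.ofReal (r ^ m) * 
        (c * A * (‖h 0‖ₑ ^ p * btW β ((r:ℂ) • (σ:E))) + (c * c₂ * C₂ * A') * (btW (β + p) ((r:ℂ) • (σ:E)) * S ((r:ℂ) • (σ:E))))) ∂(μ.toSphere) := by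
        apply lintegral_mono
        intro σ
        exact step σ (by simp)
    _ = (A * C₁) * ∫⁻ σ : Metric.sphere (0:E) 1, (∫⁻ r in Set.Ioo (0:ℝ) 1, ENNReal.ofReal (r ^ m) * 
        (c * A * (‖h 0‖ₑ ^ p * btW β ((r:ℂ) • (σ:E))) + (c * c₂ * C₂ * A') * (btW (β + p) ((r:ℂ) • (σ:E)) * S ((r:ℂ) • (σ:E))))) ∂(μ.toSphere) := 
        lintegral_const_mul' _ _ (by finiteness)
    _ = (A * C₁) * ∫⁻ z in Metric.ball 0 1, (c * A * (‖h 0‖ₑ ^ p * btW β z) + (c * c₂ * C₂ * A') * (btW (β + p) z * S z)) ∂μ := by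
        rw [hm (fun z => (c * A * (‖h 0‖ₑ ^ p * btW β z) + (c * c₂ * C₂ * A') * (btW (β + p) z * S z))) (by fun_prop)]
    _ = (A * C₁) * (c * A * (‖h 0‖ₑ ^ p * I) + (c * c₂ * C₂ * A') * ∫⁻ z in Metric.ball 0 1, (btW (β + p) z * S z) ∂μ) := by
        rw [lintegral_add_left (by fun_prop), lintegral_const_mul _ (by fun_prop), lintegral_const_mul _ (by fun_prop), lintegral_const_mul _ (by fun_prop)]
    _ ≤ (A * C₁) * (c * A * (‖h 0‖ₑ ^ p * I) + (c * c₂ * C₂ * A') * (C₃ * ∫⁻ z in Metric.ball 0 1, btW (β + p) z * ‖btR h z‖ₑ ^ p ∂μ)) := by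
        gcongr
        refine (H₃ Fp hFpm).trans_eq ?_
        congr 1
        apply setLIntegral_congr_fun measurableSet_ball
        intro z hz
        beta_reduce
        rw [hFpe z (by simpa using hz)]
    _ = (A * C₁) * ((c * A * I) * ‖h 0‖ₑ ^ p + (c * c₂ * C₂ * A' * C₃) * (∫⁻ z in Metric.ball 0 1, btW (β + p) z * ‖btR h z‖ₑ ^ p ∂μ)) := by ring
    _ ≤ (A * C₁) * ((c * A * I + c * c₂ * C₂ * A' * C₃) * ‖h 0‖ₑ ^ p + (c * A * I + c * c₂ * C₂ * A' * C₃) * (∫⁻ z in Metric.ball 0 1, btW (β + p) z * ‖btR h z‖ₑ ^ p ∂μ)) := by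
        gcongr
        · exact le_self_add
        · exact le_add_self
    _ = _ := by ring

end down2


section up
variable {E : Type*} [NormedAddCommGroup E] [InnerProductSpace ℂ E] [FiniteDimensional ℂ E]
  [MeasurableSpace E] [BorelSpace E]

lemma bt_up_mem {z : E} (hz : ‖z‖ < 1) {ζ : ℂ} (hζ : ‖ζ‖ ≤ (1 - ‖z‖^2) / 8) :
    (1 + ζ) • z ∈ btQ 4 z := by
  have hw := bt_wt_pos hz
  set w := 1 - ‖z‖^2 with hwd
  have hw1 : w ≤ 1 := by rw [hwd]; nlinarith [norm_nonneg z]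
  have h2 : ‖1 + ζ‖ ≤ 1 + w / 8 := (norm_add_le _ _).trans (by simpa using hζ)
  have h3 : ‖(1 + ζ) • z‖^2 ≤ 1 - w / 2 := by
    rw [norm_smul, mul_pow, show ‖z‖^2 = 1 - w by rw [hwd]; ring]
    calc ‖1 + ζ‖^2 * (1 - w) ≤ (1 + w/8)^2 * (1 - w) := by gcongr
      _ ≤ _ := by nlinarith [mul_pos hw hw]
  have hn : ‖(1 + ζ) • z‖ < 1 := by nlinarith [norm_nonneg ((1 + ζ) • z)]
  refine ⟨hn, ?_⟩
  rw [← hwd, inner_smul_right, inner_self_eq_norm_sq_to_K]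
  have h4 : (1:ℂ) - (1 + ζ) * ((‖z‖:ℝ):ℂ)^2 = ((w:ℝ):ℂ) - ζ * ((‖z‖:ℝ):ℂ)^2 := by
    rw [hwd]; push_cast; ring
  have h5 : ‖(1:ℂ) - (1 + ζ) * ((‖z‖:ℝ):ℂ)^2‖ ≤ w + w / 8 := by
    rw [h4]
    refine (norm_sub_le _ _).trans ?_
    rw [Complex.norm_real, Real.norm_eq_abs, abs_of_pos hw, norm_mul, norm_pow, Complex.norm_real, norm_norm]
    nlinarith [norm_nonneg z, norm_nonneg ζ]
  refine lt_of_le_of_lt (pow_le_pow_left₀ (norm_nonneg _) h5 2) ?_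
  nlinarith [mul_pos hw hw]

lemma bt_up_pt {g : E → ℂ} (hg : DifferentiableOn ℂ g (Metric.ball 0 1)) {z : E} (hz : ‖z‖ < 1)
    {X : ℝ≥0∞} (hX : ∀ u ∈ btQ 4 z, ‖g u‖ₑ ≤ X) :
    btW 1 z * ‖btR g z‖ₑ ≤ 8 * X := by
  rcases eq_or_ne X ⊤ with rfl | hXt
  · simp
  set B := X.toReal with hB
  have hB0 : 0 ≤ B := ENNReal.toReal_nonneg
  have hXB : X = ENNReal.ofReal B := (ENNReal.ofReal_toReal hXt).symm
  have hw := bt_wt_pos hz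
  set w := 1 - ‖z‖^2 with hwd
  let U : Set ℂ := {ζ | ‖(1 + ζ) • z‖ < 1}
  have hD : ∀ ζ ∈ U, HasDerivAt (fun ζ : ℂ => g ((1 + ζ) • z)) (fderiv ℂ g ((1 + ζ) • z) z) ζ := by
    intro ζ hζ
    have := (bt_hasD hg (z := z) (ζ := 1 + ζ) hζ).comp_const_add 1 ζ
    exact this
  have hmem : ∀ ζ ∈ Metric.closedBall (0:ℂ) (w/8), (1 + ζ) • z ∈ btQ 4 z := fun ζ hζ =>
    bt_up_mem hz (by simpa using hζ)
  have hsub : Metric.closedBall (0:ℂ) (w/8) ⊆ U := fun ζ hζ => (hmem ζ hζ).1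
  have hdiff : DifferentiableOn ℂ (fun ζ : ℂ => g ((1 + ζ) • z)) U :=
    fun ζ hζ => (hD ζ hζ).differentiableAt.differentiableWithinAt
  have h1 := Complex.norm_deriv_le_of_forall_mem_sphere_norm_le (c := 0) (R := w/8) (C := B) (by positivity)
    (hdiff.diffContOnCl_ball hsub) (fun ζ hζ => by
      have := hX _ (hmem ζ (Metric.sphere_subset_closedBall hζ))
      rwa [hXB, ← ofReal_norm, ENNReal.ofReal_le_ofReal_iff hB0] at this)
  rw [(hD 0 (hsub (Metric.mem_closedBall_self (by positivity)))).deriv, add_zero, one_smul, le_div_iff₀ (by positivity)] at h1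
  have h2 : w * ‖btR g z‖ ≤ 8 * B := by
    unfold btR
    linarith
  unfold btW
  rw [Real.rpow_one, ← hwd, hXB, ← ofReal_norm, ← ENNReal.ofReal_mul hw.le, show (8:ℝ≥0∞) = ENNReal.ofReal 8 by simp,
    ← ENNReal.ofReal_mul (by norm_num)]
  exact ENNReal.ofReal_le_ofReal h2

variable (μ : Measure E) [μ.IsAddHaarMeasure]

/-- integral of sup over metric balls is controlled -/
lemma bt_sup_int {p : ℝ} (hp : 0 < p) (K β : ℝ) : ∃ C : ℝ≥0∞, C ≠ ⊤ ∧
    ∀ g : E → ℂ, DifferentiableOn ℂ g (Metric.ball 0 1) → ∃ S : E → ℝ≥0∞, Measurable S ∧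
      (∀ z : E, ‖z‖ < 1 → ∀ u ∈ btQ K z, ‖g u‖ₑ ≤ S z) ∧
      ∫⁻ z in Metric.ball 0 1, btW β z * S z ^ p ∂μ ≤
        C * ∫⁻ z in Metric.ball 0 1, btW β z * ‖g z‖ₑ ^ p ∂μ := by
  obtain ⟨C₂, hC₂, H₂⟩ := btS_point (E := E) μ (K := K) hp
  obtain ⟨C₃, hC₃, H₃⟩ := btS_int (E := E) μ (512 * K) β
  refine ⟨C₂ * C₃, by finiteness, fun g hg => ?_⟩
  set Fp : E → ℝ≥0∞ := (Metric.ball 0 1).indicator (fun x => ‖g x‖ₑ ^ p) with hFp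
  have hFpm : Measurable Fp := bt_meas_ind measurableSet_ball hg.continuousOn p
  have hFpe : ∀ u : E, ‖u‖ < 1 → ‖g u‖ₑ ^ p = Fp u := fun u hu => by
    rw [hFp, Set.indicator_of_mem (by simpa using hu)]
  have hSm := btS_meas μ (512 * K) hFpm
  have hWm := btW_meas (E := E) β
  refine ⟨fun z => (C₂ * btS μ (512 * K) Fp z) ^ (1/p), by fun_prop, ?_, ?_⟩
  · intro z hz u hu
    rw [one_div, ENNReal.le_rpow_inv_iff hp, ← btS_congr μ z hFpe]
    exact H₂ _ hg z hz u hu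
  · calc _ = ∫⁻ z in Metric.ball 0 1, C₂ * (btW β z * btS μ (512 * K) Fp z) ∂μ := by
          apply lintegral_congr
          intro z
          rw [← ENNReal.rpow_mul, one_div_mul_cancel hp.ne', ENNReal.rpow_one]
          ring
      _ = C₂ * ∫⁻ z in Metric.ball 0 1, (btW β z * btS μ (512 * K) Fp z) ∂μ :=
          lintegral_const_mul' _ _ hC₂
      _ ≤ C₂ * (C₃ * ∫⁻ z in Metric.ball 0 1, btW β z * Fp z ∂μ) := by
          gcongr
          exact H₃ Fp hFpm
      _ = _ := by
          rw [mul_assoc]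
          congr 2
          apply setLIntegral_congr_fun measurableSet_ball
          intro z hz
          beta_reduce
          rw [hFpe z (by simpa using hz)]

lemma bt_up {p : ℝ} (hp : 0 < p) (β : ℝ) : ∃ C : ℝ≥0∞, C ≠ ⊤ ∧
    ∀ g : E → ℂ, DifferentiableOn ℂ g (Metric.ball 0 1) →
      ∫⁻ z in Metric.ball 0 1, btW (β + p) z * ‖btR g z‖ₑ ^ p ∂μ ≤
        C * ∫⁻ z in Metric.ball 0 1, btW β z * ‖g z‖ₑ ^ p ∂μ := by
  obtain ⟨C, hC, H⟩ := bt_sup_int (E := E) μ hp 4 β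
  refine ⟨8 ^ p * C, by finiteness, fun g hg => ?_⟩
  obtain ⟨S, hS, h1, h2⟩ := H g hg
  calc _ ≤ ∫⁻ z in Metric.ball 0 1, 8 ^ p * (btW β z * S z ^ p) ∂μ := by
        apply setLIntegral_mono' measurableSet_ball
        intro z hz
        have hz : ‖z‖ < 1 := by simpa using hz
        have h3 := bt_up_pt hg hz (h1 z hz)
        have h4 := ENNReal.rpow_le_rpow h3 hp.le
        rw [ENNReal.mul_rpow_of_nonneg _ _ hp.le, ENNReal.mul_rpow_of_nonneg _ _ hp.le, btW_rpow hz _ hp.le, one_mul] at h4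
        rw [← btW_add hz, mul_assoc]
        calc _ ≤ btW β z * (8 ^ p * S z ^ p) := by gcongr
          _ = _ := by ring
    _ = 8 ^ p * ∫⁻ z in Metric.ball 0 1, (btW β z * S z ^ p) ∂μ := lintegral_const_mul' _ _ (by finiteness)
    _ ≤ _ := by rw [mul_assoc]; gcongr

def btIt : ℕ → (E → ℂ) → E → ℂ
  | 0, f => f
  | (k + 1), f => btR (btIt k f)

lemma btIt_diff {f : E → ℂ} (hf : DifferentiableOn ℂ f (Metric.ball 0 1)) (k : ℕ) :
    DifferentiableOn ℂ (btIt k f) (Metric.ball 0 1) := by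
  induction k with
  | zero => exact hf
  | succ k ih => exact btR_diff ih

def btJ (p α : ℝ) (k : ℕ) (f : E → ℂ) : ℝ≥0∞ :=
  ∫⁻ z in Metric.ball 0 1, btW (p * k + α) z * ‖btIt k f z‖ₑ ^ p ∂μ

lemma btIt_zero (k : ℕ) (f : E → ℂ) : ‖btIt k f 0‖ₑ ≤ ‖f 0‖ₑ := by
  cases k with
  | zero => exact le_rfl
  | succ k => simp [btIt, btR]

lemma bt_chain [Nontrivial E] {p α : ℝ} (hp : 0 < p) {N : ℕ} (hN : -1 < p * N + α) (j : ℕ) :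
    ∃ C : ℝ≥0∞, C ≠ ⊤ ∧ ∀ f : E → ℂ, DifferentiableOn ℂ f (Metric.ball 0 1) →
      btJ μ p α (N + j) f ≤ C * btJ μ p α N f ∧
      btJ μ p α N f ≤ C * (‖f 0‖ₑ ^ p + btJ μ p α (N + j) f) := by
  induction j with
  | zero => exact ⟨1, by simp, fun f _ => by simp⟩
  | succ j ih =>
    obtain ⟨C, hC, H⟩ := ih
    have hβ : -1 < p * ((N + j : ℕ) : ℝ) + α := by
      push_cast
      nlinarith [mul_nonneg hp.le (Nat.cast_nonneg (α := ℝ) j)]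
    obtain ⟨C₁, hC₁, H₁⟩ := bt_up (E := E) μ hp (p * ((N + j : ℕ) : ℝ) + α)
    obtain ⟨C₂, hC₂, H₂⟩ := bt_down (E := E) μ hβ hp
    have he : p * ((N + j : ℕ) : ℝ) + α + p = p * ((N + (j+1) : ℕ) : ℝ) + α := by push_cast; ring
    refine ⟨C₁ * C + C * (1 + C₂), by finiteness, fun f hf => ?_⟩
    obtain ⟨a, b⟩ := H f hf
    have h1 := H₁ _ (btIt_diff hf (N + j))
    have h2 := H₂ _ (btIt_diff hf (N + j))
    rw [he] at h1 h2
    change btJ μ p α (N + (j+1)) f ≤ C₁ * btJ μ p α (N + j) f at h1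
    change btJ μ p α (N + j) f ≤ C₂ * (_ + btJ μ p α (N + (j+1)) f) at h2
    constructor
    · calc _ ≤ C₁ * (C * btJ μ p α N f) := h1.trans (by gcongr)
        _ = (C₁ * C) * btJ μ p α N f := by ring
        _ ≤ _ := by gcongr; exact le_self_add
    · calc _ ≤ C * (‖f 0‖ₑ ^ p + C₂ * (‖f 0‖ₑ ^ p + btJ μ p α (N + (j+1)) f)) := by
            refine b.trans ?_
            gcongr
            refine h2.trans ?_
            gcongr
            exact btIt_zero _ _
        _ ≤ C * ((‖f 0‖ₑ ^ p + btJ μ p α (N + (j+1)) f) + C₂ * (‖f 0‖ₑ ^ p + btJ μ p α (N + (j+1)) f)) := by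
            gcongr; exact le_self_add
        _ = (C * (1 + C₂)) * (‖f 0‖ₑ ^ p + btJ μ p α (N + (j+1)) f) := by ring
        _ ≤ _ := by gcongr; exact le_add_self

end up


section cmp
variable {E : Type*} [NormedAddCommGroup E] [InnerProductSpace ℂ E] [FiniteDimensional ℂ E]
  [MeasurableSpace E] [BorelSpace E] (μ : Measure E) [μ.IsAddHaarMeasure]

lemma btW_comp2 {K : ℝ} {z u : E} (hz : ‖z‖ < 1) (h : u ∈ btQ K z) (β : ℝ) :
    btW β u ≤ ENNReal.ofReal ((4 * K) ^ |β|) * btW β z :=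
  btW_comp h.1 (bt_Q_symm hz h) β

def btI (K q s α : ℝ) (g : E → ℂ) (z : E) : ℝ≥0∞ :=
  ∫⁻ u in btQ K z, btW α u * (btW s u * ‖g u‖ₑ) ^ q ∂μ

def btM (K α : ℝ) (z : E) : ℝ≥0∞ := ∫⁻ u in btQ K z, btW α u ∂μ

lemma bt_vol (K α : ℝ) : ∃ C : ℝ≥0∞, C ≠ ⊤ ∧ ∀ z : E, ‖z‖ < 1 →
    btM μ K α z ≤ C * btW (α + ((Module.finrank ℂ E : ℝ) + 1)) z := by
  refine ⟨ENNReal.ofReal ((4 * K) ^ |α|) * μ (Metric.ball 0 (2 * K)), ?_, fun z hz => ?_⟩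
  · have : μ (Metric.ball 0 (2 * K)) ≠ ⊤ := measure_ball_lt_top.ne
    finiteness
  calc btM μ K α z ≤ ∫⁻ u in btQ K z, ENNReal.ofReal ((4 * K) ^ |α|) * btW α z ∂μ :=
        setLIntegral_mono' (bt_Q_meas K z) fun u hu => btW_comp2 hz hu α
    _ = ENNReal.ofReal ((4 * K) ^ |α|) * btW α z * μ (btQ K z) := by rw [setLIntegral_const]
    _ ≤ ENNReal.ofReal ((4 * K) ^ |α|) * btW α z *
          (btW ((Module.finrank ℂ E : ℝ) + 1) z * μ (Metric.ball 0 (2 * K))) := by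
        gcongr
        have := bt_Q_vol μ K z hz
        rw [← btW_nat] at this
        push_cast at this
        exact this
    _ = ENNReal.ofReal ((4 * K) ^ |α|) * μ (Metric.ball 0 (2 * K)) *
          (btW α z * btW ((Module.finrank ℂ E : ℝ) + 1) z) := by ring
    _ = _ := by rw [btW_add hz]

lemma btI_up {q : ℝ} (hq : 0 < q) (K s α : ℝ) (g : E → ℂ) {z : E} (hz : ‖z‖ < 1) {X : ℝ≥0∞}
    (hX : ∀ u ∈ btQ K z, ‖g u‖ₑ ≤ X) :
    btI μ K q s α g z ≤ btM μ K α z * (ENNReal.ofReal ((4 * K) ^ |s|) * btW s z * X) ^ q := by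
  unfold btI btM
  rw [← lintegral_mul_const _ (btW_meas α)]
  apply setLIntegral_mono' (bt_Q_meas K z)
  intro u hu
  gcongr
  · exact btW_comp2 hz hu s
  · exact hX u hu

lemma btI_low {q K : ℝ} (hq : 0 < q) (hK : 1 < K) (s α : ℝ) : ∃ C : ℝ≥0∞, C ≠ ⊤ ∧
    ∀ g : E → ℂ, DifferentiableOn ℂ g (Metric.ball 0 1) → ∀ z : E, ‖z‖ < 1 →
      btW (α + ((Module.finrank ℂ E : ℝ) + 1)) z * (btW s z * ‖g z‖ₑ) ^ q ≤
        C * btI μ K q s α g z := by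
  obtain ⟨C, hC, H⟩ := bt_submean (E := E) μ hq hK
  refine ⟨ENNReal.ofReal ((4 * K) ^ |α + s * q|) * C, by finiteness, fun g hg z hz => ?_⟩
  have h1 := H g hg z hz
  rw [← btW_nat] at h1
  push_cast at h1
  calc _ = btW (α + s * q) z * (btW ((Module.finrank ℂ E : ℝ) + 1) z * ‖g z‖ₑ ^ q) := by
        rw [ENNReal.mul_rpow_of_nonneg _ _ hq.le, btW_rpow hz _ hq.le, ← btW_add hz α ((Module.finrank ℂ E : ℝ) + 1), ← btW_add hz α (s * q)]
        ring
    _ ≤ btW (α + s * q) z * (C * ∫⁻ u in btQ K z, ‖g u‖ₑ ^ q ∂μ) := by gcongr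
    _ = C * ∫⁻ u in btQ K z, btW (α + s * q) z * ‖g u‖ₑ ^ q ∂μ := by
        rw [lintegral_const_mul' _ _ (btW_ne_top _ _)]
        ring
    _ ≤ C * ∫⁻ u in btQ K z, ENNReal.ofReal ((4 * K) ^ |α + s * q|) *
          (btW α u * (btW s u * ‖g u‖ₑ) ^ q) ∂μ := by
        gcongr C * ?_
        apply setLIntegral_mono' (bt_Q_meas K z)
        intro u hu
        rw [ENNReal.mul_rpow_of_nonneg _ _ hq.le, btW_rpow hu.1 _ hq.le, ← mul_assoc, ← mul_assoc, mul_assoc (ENNReal.ofReal _),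
          btW_add hu.1]
        gcongr
        exact btW_comp hz hu _
    _ = _ := by
        rw [lintegral_const_mul' _ _ ENNReal.ofReal_ne_top]
        unfold btI
        ring

/-- area function -/
def btAr (K q s : ℝ) (g : E → ℂ) (z : E) : ℝ≥0∞ :=
  (btI μ K q s (-((Module.finrank ℂ E : ℝ) + 1)) g z) ^ (1/q)

/-- maximal function -/
def btMx (K q s α : ℝ) (g : E → ℂ) (z : E) : ℝ≥0∞ :=
  ⨆ w ∈ {w : E | ‖w‖ < 1 ∧ z ∈ btQ K w}, ((btM μ K α w)⁻¹ * btI μ K q s α g w) ^ (1/q)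

lemma btAr_cmp {q K : ℝ} (hq : 0 < q) (hK : 1 < K) (s : ℝ) : ∃ C : ℝ≥0∞, C ≠ ⊤ ∧
    ∀ g : E → ℂ, DifferentiableOn ℂ g (Metric.ball 0 1) → ∀ z : E, ‖z‖ < 1 →
      btW s z * ‖g z‖ₑ ≤ C * btAr μ K q s g z ∧
      ∀ X : ℝ≥0∞, (∀ u ∈ btQ (256 * K * K) z, ‖g u‖ₑ ≤ X) → btAr μ K q s g z ≤ C * (btW s z * X) := by
  obtain ⟨C₁, hC₁, H₁⟩ := btI_low (E := E) μ hq hK s (-((Module.finrank ℂ E : ℝ) + 1))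
  obtain ⟨C₂, hC₂, H₂⟩ := bt_vol (E := E) μ K (-((Module.finrank ℂ E : ℝ) + 1))
  have hq' : 0 < 1/q := by positivity
  refine ⟨C₁ ^ (1/q) + C₂ ^ (1/q) * ENNReal.ofReal ((4 * K) ^ |s|), by finiteness, fun g hg z hz => ⟨?_, fun X hX => ?_⟩⟩
  · have h1 := H₁ g hg z hz
    rw [neg_add_cancel, btW_zero, one_mul] at h1
    have h2 := ENNReal.rpow_le_rpow h1 hq'.le
    rw [← ENNReal.rpow_mul, mul_one_div_cancel hq.ne', ENNReal.rpow_one, ENNReal.mul_rpow_of_nonneg _ _ hq'.le] at h2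
    refine h2.trans ?_
    unfold btAr
    gcongr
    exact le_self_add
  · have h1 := btI_up μ hq K s (-((Module.finrank ℂ E : ℝ) + 1)) g hz (X := X) (fun u hu => hX u
      (bt_Q_mono (by nlinarith) hz hu))
    have h3 := H₂ z hz
    rw [neg_add_cancel, btW_zero, mul_one] at h3
    have h4 : btI μ K q s (-((Module.finrank ℂ E : ℝ) + 1)) g z ≤ C₂ * (ENNReal.ofReal ((4 * K) ^ |s|) * btW s z * X) ^ q :=
      h1.trans (by gcongr)
    have h2 := ENNReal.rpow_le_rpow h4 hq'.le
    rw [ENNReal.mul_rpow_of_nonneg _ _ hq'.le, ← ENNReal.rpow_mul, mul_one_div_cancel hq.ne', ENNReal.rpow_one] at h2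
    unfold btAr
    calc _ ≤ _ := h2
      _ = (C₂ ^ (1/q) * ENNReal.ofReal ((4 * K) ^ |s|)) * (btW s z * X) := by ring
      _ ≤ _ := by gcongr; exact le_add_self

lemma bt_Q_self {K : ℝ} (hK : 1 < K) {z : E} (hz : ‖z‖ < 1) : z ∈ btQ K z := by
  obtain ⟨ε, h0, h1, hε⟩ := bt_exists_eps (E := E) hK
  have := hε z hz 0 (by simpa using h0)
  simpa using this

lemma btMx_cmp {q K : ℝ} (hq : 0 < q) (hK : 1 < K) (s α : ℝ) : ∃ C : ℝ≥0∞, C ≠ ⊤ ∧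
    ∀ g : E → ℂ, DifferentiableOn ℂ g (Metric.ball 0 1) → ∀ z : E, ‖z‖ < 1 →
      btW s z * ‖g z‖ₑ ≤ C * btMx μ K q s α g z ∧
      ∀ X : ℝ≥0∞, (∀ u ∈ btQ (256 * K * K) z, ‖g u‖ₑ ≤ X) → btMx μ K q s α g z ≤ C * (btW s z * X) := by
  obtain ⟨C₁, hC₁, H₁⟩ := btI_low (E := E) μ hq hK s α
  obtain ⟨C₂, hC₂, H₂⟩ := bt_vol (E := E) μ K α
  have hq' : 0 < 1/q := by positivity
  set c := ENNReal.ofReal ((4 * K) ^ |s|) with hc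
  refine ⟨((C₂ + 1) * C₁) ^ (1/q) + c * c, by finiteness, fun g hg z hz => ⟨?_, fun X hX => ?_⟩⟩
  · have h1 := H₁ g hg z hz
    set W := btW (α + ((Module.finrank ℂ E : ℝ) + 1)) z with hW
    have hW0 : W ≠ 0 := btW_ne_zero hz _
    have hWt : W ≠ ⊤ := btW_ne_top _ _
    have h2 : btM μ K α z ≤ (C₂ + 1) * W := (H₂ z hz).trans (by gcongr; exact le_self_add)
    have h3 : W⁻¹ ≤ (C₂ + 1) * (btM μ K α z)⁻¹ := by
      have h4 := ENNReal.inv_le_inv.2 h2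
      rw [ENNReal.mul_inv (Or.inr hWt) (Or.inr hW0)] at h4
      calc W⁻¹ = (C₂ + 1) * ((C₂ + 1)⁻¹ * W⁻¹) := by
            rw [← mul_assoc, ENNReal.mul_inv_cancel (by simp) (by finiteness), one_mul]
        _ ≤ _ := by gcongr
    have h5 : (btW s z * ‖g z‖ₑ) ^ q ≤ ((C₂ + 1) * C₁) * ((btM μ K α z)⁻¹ * btI μ K q s α g z) := by
      calc _ = W⁻¹ * (W * (btW s z * ‖g z‖ₑ) ^ q) := by
            rw [← mul_assoc, ENNReal.inv_mul_cancel hW0 hWt, one_mul]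
        _ ≤ ((C₂ + 1) * (btM μ K α z)⁻¹) * (C₁ * btI μ K q s α g z) := by gcongr
        _ = _ := by ring
    have h6 := ENNReal.rpow_le_rpow h5 hq'.le
    rw [← ENNReal.rpow_mul, mul_one_div_cancel hq.ne', ENNReal.rpow_one, ENNReal.mul_rpow_of_nonneg _ _ hq'.le] at h6
    refine h6.trans ?_
    gcongr
    · exact le_self_add
    · unfold btMx
      exact le_iSup₂ (f := fun w (_ : w ∈ {w : E | ‖w‖ < 1 ∧ z ∈ btQ K w}) => ((btM μ K α w)⁻¹ * btI μ K q s α g w) ^ (1/q)) z ⟨hz, bt_Q_self hK hz⟩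
  · unfold btMx
    apply iSup₂_le
    rintro w ⟨hw, hzw⟩
    have h1 := btI_up μ hq K s α g hw (X := X) (fun u hu => hX u (bt_Q_trans hz (bt_Q_symm hw hzw) hu))
    have h2 : (btM μ K α w)⁻¹ * btI μ K q s α g w ≤ (c * btW s w * X) ^ q := by
      calc _ ≤ (btM μ K α w)⁻¹ * (btM μ K α w * (c * btW s w * X) ^ q) := by gcongr
        _ = ((btM μ K α w)⁻¹ * btM μ K α w) * (c * btW s w * X) ^ q := by ring
        _ ≤ 1 * (c * btW s w * X) ^ q := by
            gcongr
            exact ENNReal.inv_mul_le_one _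
        _ = _ := one_mul _
    have h3 := ENNReal.rpow_le_rpow h2 hq'.le
    rw [← ENNReal.rpow_mul, mul_one_div_cancel hq.ne', ENNReal.rpow_one] at h3
    refine h3.trans ?_
    have h4 := btW_comp hw hzw s
    calc _ ≤ c * (c * btW s z) * X := by gcongr
      _ = (c * c) * (btW s z * X) := by ring
      _ ≤ _ := by gcongr; exact le_add_self

lemma bt_sand {p : ℝ} (hp : 0 < p) (K α : ℝ) (k : ℕ) {C : ℝ≥0∞} (hC : C ≠ ⊤) : ∃ D : ℝ≥0∞, D ≠ ⊤ ∧
    ∀ f : E → ℂ, DifferentiableOn ℂ f (Metric.ball 0 1) → ∀ T : E → ℝ≥0∞,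
      (∀ z : E, ‖z‖ < 1 →
        btW k z * ‖btIt k f z‖ₑ ≤ C * T z ∧
        ∀ X : ℝ≥0∞, (∀ u ∈ btQ K z, ‖btIt k f u‖ₑ ≤ X) → T z ≤ C * (btW k z * X)) →
      btJ μ p α k f ≤ D * ∫⁻ z in Metric.ball 0 1, btW α z * T z ^ p ∂μ ∧
      ∫⁻ z in Metric.ball 0 1, btW α z * T z ^ p ∂μ ≤ D * btJ μ p α k f := by
  obtain ⟨C₁, hC₁, H₁⟩ := bt_sup_int (E := E) μ hp K (p * k + α)
  refine ⟨C ^ p + C ^ p * C₁, by finiteness, fun f hf T hT => ⟨?_, ?_⟩⟩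
  · calc btJ μ p α k f ≤ ∫⁻ z in Metric.ball 0 1, C ^ p * (btW α z * T z ^ p) ∂μ := by
          apply setLIntegral_mono' measurableSet_ball
          intro z hz
          have hz : ‖z‖ < 1 := by simpa using hz
          have h1 := ENNReal.rpow_le_rpow (hT z hz).1 hp.le
          rw [ENNReal.mul_rpow_of_nonneg _ _ hp.le, ENNReal.mul_rpow_of_nonneg _ _ hp.le, btW_rpow hz _ hp.le] at h1
          rw [add_comm, ← btW_add hz, mul_assoc, mul_comm p]
          calc _ ≤ btW α z * (C ^ p * T z ^ p) := by gcongr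
            _ = _ := by ring
      _ = C ^ p * ∫⁻ z in Metric.ball 0 1, (btW α z * T z ^ p) ∂μ := lintegral_const_mul' _ _ (by finiteness)
      _ ≤ _ := by gcongr; exact le_self_add
  · obtain ⟨S, hS, h1, h2⟩ := H₁ _ (btIt_diff hf k)
    calc _ ≤ ∫⁻ z in Metric.ball 0 1, C ^ p * (btW (p * k + α) z * S z ^ p) ∂μ := by
          apply setLIntegral_mono' measurableSet_ball
          intro z hz
          have hz : ‖z‖ < 1 := by simpa using hz
          have h1 := ENNReal.rpow_le_rpow ((hT z hz).2 (S z) (h1 z hz)) hp.le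
          rw [ENNReal.mul_rpow_of_nonneg _ _ hp.le, ENNReal.mul_rpow_of_nonneg _ _ hp.le, btW_rpow hz _ hp.le] at h1
          rw [add_comm, ← btW_add hz, mul_comm p]
          calc _ ≤ btW α z * (C ^ p * (btW (k * p) z * S z ^ p)) := by gcongr
            _ = _ := by ring
      _ = C ^ p * ∫⁻ z in Metric.ball 0 1, (btW (p * k + α) z * S z ^ p) ∂μ := lintegral_const_mul' _ _ (by finiteness)
      _ ≤ C ^ p * (C₁ * btJ μ p α k f) := by gcongr; exact h2
      _ = (C ^ p * C₁) * btJ μ p α k f := by ring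
      _ ≤ _ := by gcongr; exact le_add_self

end cmp


section final

instance bt_volH (n : ℕ) : (vol n).IsAddHaarMeasure := by unfold vol; infer_instance

lemma bt_herm {n : ℕ} (z w : En n) : herm z w = inner ℂ w z := by
  simp [herm, PiLp.inner_apply]

lemma bt_mobius {n : ℕ} {z u : En n} (hz : ‖z‖ < 1) (hu : ‖u‖ < 1) :
    ‖1 - inner ℂ z u‖ ^ 2 * (1 - ‖mobius z u‖ ^ 2) = (1 - ‖z‖^2) * (1 - ‖u‖^2) := by
  have hw := bt_wt_pos hz
  set a : ℂ := inner ℂ z u with ha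
  have hane : (1:ℂ) - a ≠ 0 := by
    intro h
    have h1 : ‖a‖ = 1 := by rw [← sub_eq_zero.1 h]; simp
    have h2 := norm_inner_le_norm (𝕜 := ℂ) z u
    rw [← ha, h1] at h2
    nlinarith [norm_nonneg z, norm_nonneg u]
  have hN : ‖(1:ℂ) - a‖ ≠ 0 := norm_ne_zero_iff.2 hane
  set s := Real.sqrt (1 - ‖z‖^2) with hs
  have hs2 : s ^ 2 = 1 - ‖z‖^2 := Real.sq_sqrt hw.le
  have hs0 : 0 ≤ s := Real.sqrt_nonneg _
  have h1a : ‖(1:ℂ) - a‖^2 = 1 - 2 * a.re + ‖a‖^2 := by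
    rw [← Complex.normSq_eq_norm_sq, ← Complex.normSq_eq_norm_sq, Complex.normSq_apply, Complex.normSq_apply]
    simp
    ring
  have key : ‖z - prj z u - (s:ℂ) • (u - prj z u)‖^2 = ‖(1:ℂ) - a‖^2 - (1 - ‖z‖^2) * (1 - ‖u‖^2) := by
    by_cases h0 : z = 0
    · have : a = 0 := by rw [ha, h0]; simp
      rw [this, prj, if_pos h0, sub_zero, sub_zero, h0, zero_sub, norm_neg, norm_smul, mul_pow, Complex.norm_real, Real.norm_eq_abs, sq_abs, hs2, h0]
      simp
    · have ht : 0 < ‖z‖ := norm_pos_iff.2 h0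
      have hzz : inner ℂ z z = ((‖z‖^2 : ℝ) : ℂ) := by
        rw [inner_self_eq_norm_sq_to_K]; push_cast; rfl
      have htc : ((‖z‖^2 : ℝ) : ℂ) ≠ 0 := by exact_mod_cast (pow_pos ht 2).ne'
      have hP : prj z u = (a / ((‖z‖^2 : ℝ) : ℂ)) • z := by
        rw [prj, if_neg h0, bt_herm, bt_herm, hzz]
      set P := prj z u with hPd
      have hzP : inner ℂ z P = a := by
        rw [hP, inner_smul_right, hzz]; field_simp
      have hzy : inner ℂ z (u - P) = 0 := by rw [inner_sub_right, hzP, ← ha, sub_self]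
      have hPy : inner ℂ P (u - P) = 0 := by rw [hP, inner_smul_left, ← hP, hzy, mul_zero]
      have hxy : inner ℂ (z - P) ((s:ℂ) • (u - P)) = 0 := by
        rw [inner_smul_right, inner_sub_left, hzy, hPy]; simp
      have hPn : ‖P‖^2 = ‖a‖^2 / ‖z‖^2 := by
        rw [hP, norm_smul, norm_div, Complex.norm_real, Real.norm_eq_abs, abs_of_pos (by positivity)]
        field_simp
      have hx : ‖z - P‖^2 = ‖z‖^2 - 2 * a.re + ‖a‖^2 / ‖z‖^2 := by
        rw [norm_sub_sq (𝕜 := ℂ), hzP, hPn]; rfl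
      have hu2 : ‖u‖^2 = ‖u - P‖^2 + ‖P‖^2 := by
        have := norm_add_sq (𝕜 := ℂ) P (u - P)
        rw [hPy] at this
        simp only [add_sub_cancel, map_zero, mul_zero, add_zero] at this
        linarith
      rw [norm_sub_sq (𝕜 := ℂ), hxy, norm_smul, mul_pow, Complex.norm_real, Real.norm_eq_abs, sq_abs, hs2, hx, h1a]
      have hy : ‖u - P‖^2 = ‖u‖^2 - ‖a‖^2 / ‖z‖^2 := by rw [hu2, hPn]; ring
      rw [hy]
      simp only [map_zero]
      field_simp
      ring
  have : ‖mobius z u‖^2 = (‖(1:ℂ) - a‖^2)⁻¹ * ‖z - prj z u - (s:ℂ) • (u - prj z u)‖^2 := by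
    rw [mobius, bt_herm, norm_smul, mul_pow, ← ha, ← hs, norm_div, norm_one, one_div, inv_pow]
  rw [this, key]
  field_simp
  ring

def btK (γ : ℝ) : ℝ := (Real.exp (2 * γ) + 1) ^ 2 / (4 * Real.exp (2 * γ))

lemma btK_gt {γ : ℝ} (hγ : 0 < γ) : 1 < btK γ := by
  have : 1 < Real.exp (2 * γ) := by rw [Real.one_lt_exp_iff]; linarith
  unfold btK
  rw [one_lt_div (by positivity)]
  nlinarith [sq_pos_of_pos (sub_pos.2 this)]

lemma bt_Dball {n : ℕ} {γ : ℝ} (hγ : 0 < γ) {z : En n} (hz : ‖z‖ < 1) :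
    Dball z γ = btQ (btK γ) z := by
  ext u
  have he : 1 < Real.exp (2 * γ) := by rw [Real.one_lt_exp_iff]; linarith
  constructor
  all_goals
    rintro ⟨h1, h2⟩
    have hu : ‖u‖ < 1 := by simpa [uball] using h1
    have hid := bt_mobius hz hu
    have hm0 := norm_nonneg (mobius z u)
    have hww := mul_pos (bt_wt_pos hz) (bt_wt_pos hu)
    have hm1 : ‖mobius z u‖ < 1 := by
      by_contra h
      push Not at h
      have h3 : 1 - ‖mobius z u‖^2 ≤ 0 := by nlinarith
      have := mul_nonpos_of_nonneg_of_nonpos (sq_nonneg ‖1 - inner ℂ z u‖) h3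
      nlinarith
    have hB : 0 < ‖1 - inner ℂ z u‖^2 := by
      by_contra h
      push Not at h
      nlinarith
    set m := ‖mobius z u‖ with hm
    have e1 : bmet z u < γ ↔ 1 + m < Real.exp (2 * γ) * (1 - m) := by
      unfold bmet
      rw [← hm]
      have hpos : 0 < (1 + m) / (1 - m) := div_pos (by linarith) (by linarith)
      rw [← div_lt_iff₀ (by linarith), ← Real.log_lt_iff_lt_exp hpos]
      constructor <;> intro <;> linarith
    have e2 : ‖1 - inner ℂ z u‖^2 < btK γ * ((1 - ‖z‖^2) * (1 - ‖u‖^2)) ↔ 1 < btK γ * (1 - m^2) := by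
      rw [← hid]
      constructor
      · intro h
        by_contra h'
        push Not at h'
        nlinarith
      · intro h
        nlinarith
    have e3 : 1 < btK γ * (1 - m^2) ↔ 1 + m < Real.exp (2 * γ) * (1 - m) := by
      unfold btK
      set e := Real.exp (2 * γ)
      rw [div_mul_eq_mul_div, one_lt_div (by positivity)]
      constructor
      · intro h
        have : ((e + 1) * m)^2 < (e - 1)^2 := by nlinarith
        have := lt_of_pow_lt_pow_left₀ 2 (by linarith) this
        linarith
      · intro h
        have : (e + 1) * m < e - 1 := by linarith
        have : ((e + 1) * m)^2 < (e - 1)^2 := by gcongr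
        nlinarith
  · exact ⟨hu, e2.2 (e3.2 (e1.1 h2))⟩
  · exact ⟨by simpa [uball] using h1, e1.2 (e3.1 (e2.1 h2))⟩

lemma bt_radIter {n : ℕ} (k : ℕ) (f : En n → ℂ) : radIter k f = btIt k f := by
  induction k with
  | zero => rfl
  | succ k ih => 
    show radD (radIter k f) = btR (btIt k f)
    rw [ih]; rfl

lemma bt_cnorm (n : ℕ) (α : ℝ) : 0 < cnorm n α := by
  unfold cnorm
  split_ifs with h
  · have h1 : 0 < Real.Gamma (n + α + 1) := Real.Gamma_pos_of_pos (by
      have : (0:ℝ) ≤ n := Nat.cast_nonneg n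
      linarith)
    have h2 : 0 < Real.Gamma (α + 1) := Real.Gamma_pos_of_pos (by linarith)
    have h3 : (0:ℝ) < n.factorial := by exact_mod_cast n.factorial_pos
    positivity
  · exact one_pos

lemma bt_measA (n : ℕ) (α : ℝ) (F : En n → ℝ≥0∞) :
    ∫⁻ z, F z ∂measA n α = ENNReal.ofReal (cnorm n α) * ∫⁻ z in Metric.ball 0 1, btW α z * F z ∂(vol n) := by
  unfold measA
  rw [lintegral_withDensity_eq_lintegral_mul_non_measurable _ (by fun_prop) (ae_of_all _ fun _ => ENNReal.ofReal_lt_top),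
    ← lintegral_const_mul' _ _ ENNReal.ofReal_ne_top]
  apply lintegral_congr
  intro z
  simp only [Pi.mul_apply]
  rw [ENNReal.ofReal_mul (bt_cnorm n α).le, mul_assoc]
  rfl

lemma bt_measA_set (n : ℕ) (α K : ℝ) (z : En n) (F : En n → ℝ≥0∞) :
    ∫⁻ u in btQ K z, F u ∂measA n α = ENNReal.ofReal (cnorm n α) * ∫⁻ u in btQ K z, btW α u * F u ∂(vol n) := by
  have hsub : btQ K z ∩ uball n = btQ K z := Set.inter_eq_left.2 fun u hu => by simpa [uball] using hu.1
  unfold measA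
  rw [restrict_withDensity (bt_Q_meas K z), Measure.restrict_restrict (bt_Q_meas K z), hsub,
    lintegral_withDensity_eq_lintegral_mul_non_measurable _ (by fun_prop) (ae_of_all _ fun _ => ENNReal.ofReal_lt_top),
    ← lintegral_const_mul' _ _ ENNReal.ofReal_ne_top]
  apply lintegral_congr
  intro z
  simp only [Pi.mul_apply]
  rw [ENNReal.ofReal_mul (bt_cnorm n α).le, mul_assoc]
  rfl

lemma bt_measTau_set (n : ℕ) (K : ℝ) (z : En n) (F : En n → ℝ≥0∞) :
    ∫⁻ u in btQ K z, F u ∂measTau n = ∫⁻ u in btQ K z, btW (-((n:ℝ)+1)) u * F u ∂(vol n) := by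
  have hsub : btQ K z ∩ uball n = btQ K z := Set.inter_eq_left.2 fun u hu => by simpa [uball] using hu.1
  unfold measTau
  rw [restrict_withDensity (bt_Q_meas K z), Measure.restrict_restrict (bt_Q_meas K z), hsub,
    lintegral_withDensity_eq_lintegral_mul_non_measurable _ (by fun_prop) (ae_of_all _ fun _ => ENNReal.ofReal_lt_top)]
  rfl

lemma bt_ofReal {n : ℕ} (k : ℕ) (f : En n → ℂ) {u : En n} (hu : ‖u‖ < 1) :
    ENNReal.ofReal ((1 - ‖u‖ ^ 2) ^ (k : ℝ) * ‖radIter k f u‖) = btW k u * ‖btIt k f u‖ₑ := by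
  have := bt_wt_pos hu
  rw [ENNReal.ofReal_mul (by positivity), bt_radIter, ofReal_norm]
  rfl

lemma bt_areaF {n : ℕ} {γ : ℝ} (hγ : 0 < γ) (q : ℝ) (k : ℕ) (f : En n → ℂ) {z : En n} (hz : ‖z‖ < 1) :
    areaF γ q (fun u => (1 - ‖u‖ ^ 2) ^ (k : ℝ) * ‖radIter k f u‖) z =
      btAr (vol n) (btK γ) q k (btIt k f) z := by
  unfold areaF btAr btI
  rw [bt_Dball hγ hz, bt_measTau_set, finrank_euclideanSpace_fin]
  congr 1
  apply setLIntegral_congr_fun (bt_Q_meas _ z)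
  intro u hu
  beta_reduce
  rw [bt_ofReal k f hu.1]

lemma bt_maxHL {n : ℕ} {γ : ℝ} (hγ : 0 < γ) (q α : ℝ) (k : ℕ) (f : En n → ℂ) (z : En n) :
    maxHL γ q α (fun u => (1 - ‖u‖ ^ 2) ^ (k : ℝ) * ‖radIter k f u‖) z =
      btMx (vol n) (btK γ) q k α (btIt k f) z := by
  unfold maxHL btMx
  have hset : {w : En n | w ∈ uball n ∧ z ∈ Dball w γ} = {w : En n | ‖w‖ < 1 ∧ z ∈ btQ (btK γ) w} := by
    ext w
    constructor
    · rintro ⟨h1, h2⟩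
      have h1 : ‖w‖ < 1 := by simpa [uball] using h1
      exact ⟨h1, by rwa [bt_Dball hγ h1] at h2⟩
    · rintro ⟨h1, h2⟩
      exact ⟨by simpa [uball] using h1, by rwa [bt_Dball hγ h1]⟩
  rw [hset]
  refine iSup_congr fun w => iSup_congr fun hw => ?_
  have hw1 : ‖w‖ < 1 := hw.1
  rw [bt_Dball hγ hw1, bt_measA_set]
  have h1 : measA n α (btQ (btK γ) w) = ENNReal.ofReal (cnorm n α) * btM (vol n) (btK γ) α w := by
    have := bt_measA_set n α (btK γ) w (fun _ => 1)
    rw [setLIntegral_const, one_mul] at this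
    rw [this]
    simp only [mul_one]
    rfl
  have hc0 : ENNReal.ofReal (cnorm n α) ≠ 0 := by simpa using bt_cnorm n α
  have hct : ENNReal.ofReal (cnorm n α) ≠ ⊤ := ENNReal.ofReal_ne_top
  have h2 : ∫⁻ u in btQ (btK γ) w, btW α u * ENNReal.ofReal ((1 - ‖u‖ ^ 2) ^ (k : ℝ) * ‖radIter k f u‖) ^ q ∂(vol n)
      = btI (vol n) (btK γ) q k α (btIt k f) w := by
    apply setLIntegral_congr_fun (bt_Q_meas _ w)
    intro u hu
    beta_reduce
    rw [bt_ofReal k f hu.1]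
  rw [h1, h2, ENNReal.mul_inv (Or.inl hc0) (Or.inl hct)]
  congr 1
  calc _ = ((ENNReal.ofReal (cnorm n α))⁻¹ * ENNReal.ofReal (cnorm n α)) * ((btM (vol n) (btK γ) α w)⁻¹ * btI (vol n) (btK γ) q k α (btIt k f) w) := by ring
    _ = _ := by rw [ENNReal.inv_mul_cancel hc0 hct, one_mul]

lemma bt_comb {p : ℝ} (hp : 0 < p) {c D : ℝ≥0∞} (hc : c ≠ ⊤) (hD : D ≠ ⊤) : ∃ C : ℝ≥0∞, C ≠ ⊤ ∧
    ∀ a X J : ℝ≥0∞, X ≤ D * (a ^ p + J) → a + (c * X) ^ (1/p) ≤ C * (a + (c * J) ^ (1/p)) := by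
  have hp' : 0 < 1/p := by positivity
  set t := ENNReal.ofReal ((1 + 1) ^ (1/p)) with ht
  refine ⟨1 + (t * (c * D) ^ (1/p) + t * D ^ (1/p)), by finiteness, fun a X J h => ?_⟩
  have h1 : c * X ≤ (c * D) * a ^ p + D * (c * J) := by
    calc _ ≤ c * (D * (a ^ p + J)) := by gcongr
      _ = _ := by ring
  have h2 := ENNReal.rpow_le_rpow h1 hp'.le
  have h3 := bt_add_rpow hp' one_pos ((c * D) * a ^ p) (D * (c * J))
  rw [ENNReal.mul_rpow_of_nonneg (c * D) (a ^ p) hp'.le, ← ENNReal.rpow_mul, mul_one_div_cancel hp.ne', ENNReal.rpow_one,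
    ENNReal.mul_rpow_of_nonneg D (c * J) hp'.le, div_one] at h3
  calc _ ≤ a + (t * ((c * D) ^ (1/p) * a) + t * (D ^ (1/p) * (c * J) ^ (1/p))) := by
        gcongr; exact h2.trans h3
    _ = (1 + t * (c * D) ^ (1/p)) * a + (t * D ^ (1/p)) * (c * J) ^ (1/p) := by ring
    _ ≤ (1 + (t * (c * D) ^ (1/p) + t * D ^ (1/p))) * a + (1 + (t * (c * D) ^ (1/p) + t * D ^ (1/p))) * (c * J) ^ (1/p) := by
        gcongr
        · exact le_self_add
        · rw [← add_assoc]; exact le_add_self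
    _ = _ := by ring

/-- one-sided transfer for either functional -/
lemma bt_main (n : ℕ) (hn : 1 ≤ n) (α p : ℝ) (k : ℕ) (hp : 0 < p) (hk : p * k + α > -1) (K : ℝ)
    {C₀ : ℝ≥0∞} (hC₀ : C₀ ≠ ⊤) :
    ∃ C : ℝ≥0∞, C ≠ ⊤ ∧ ∀ f : En n → ℂ, DifferentiableOn ℂ f (uball n) → ∀ T : En n → ℝ≥0∞,
      (∀ z : En n, ‖z‖ < 1 →
        btW k z * ‖btIt k f z‖ₑ ≤ C₀ * T z ∧
        ∀ X : ℝ≥0∞, (∀ u ∈ btQ K z, ‖btIt k f u‖ₑ ≤ X) → T z ≤ C₀ * (btW k z * X)) →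
      ENNReal.ofReal ‖f 0‖ + (∫⁻ z, T z ^ p ∂measA n α) ^ (1/p) ≤ C * gapnorm n p α f ∧
      gapnorm n p α f ≤ C * (ENNReal.ofReal ‖f 0‖ + (∫⁻ z, T z ^ p ∂measA n α) ^ (1/p)) := by
  have : Nontrivial (En n) := by
    have : Nonempty (Fin n) := ⟨⟨0, hn⟩⟩
    infer_instance
  have hmem : k ∈ {k : ℕ | p * k + α > -1} := hk
  have hN : p * (Nmin p α : ℕ) + α > -1 := Nat.sInf_mem (s := {k : ℕ | p * k + α > -1}) ⟨k, hmem⟩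
  have hle : Nmin p α ≤ k := Nat.sInf_le hmem
  obtain ⟨j, hj⟩ := Nat.exists_eq_add_of_le hle
  set N := Nmin p α with hNd
  obtain ⟨C₁, hC₁, H₁⟩ := bt_chain (vol n) hp hN j
  obtain ⟨D, hD, H₂⟩ := bt_sand (vol n) hp K α k hC₀
  set c := ENNReal.ofReal (cnorm n α) with hc
  obtain ⟨C₂, hC₂, H₃⟩ := bt_comb hp (c := c) (D := D * C₁ + C₁ * (1 + D)) ENNReal.ofReal_ne_top (by finiteness)
  refine ⟨C₂, hC₂, fun f hf T hT => ?_⟩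
  have hgap : gapnorm n p α f = ‖f 0‖ₑ + (c * btJ (vol n) p α N f) ^ (1/p) := by
    unfold gapnorm
    rw [bt_measA, ofReal_norm]
    congr 3
    apply setLIntegral_congr_fun measurableSet_ball
    intro z hz
    have hz : ‖z‖ < 1 := by simpa using hz
    have := bt_wt_pos hz
    beta_reduce
    rw [← hNd, ENNReal.ofReal_mul (by positivity), add_comm, ← btW_add hz, bt_radIter, mul_assoc,
      ← ENNReal.ofReal_rpow_of_nonneg (norm_nonneg _) hp.le, ofReal_norm]
    rfl
  rw [hgap, ofReal_norm, bt_measA, ← hc]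
  obtain ⟨a1, a2⟩ := H₁ f hf
  rw [← hj] at a1 a2
  obtain ⟨b1, b2⟩ := H₂ f hf T hT
  set Y := ∫⁻ z in Metric.ball 0 1, btW α z * T z ^ p ∂(vol n)
  constructor
  · apply H₃
    calc Y ≤ D * (C₁ * btJ (vol n) p α N f) := b2.trans (by gcongr)
      _ = (D * C₁) * btJ (vol n) p α N f := by ring
      _ ≤ _ := by
        gcongr
        · exact le_self_add
        · exact le_add_self
  · apply H₃
    calc btJ (vol n) p α N f ≤ C₁ * (‖f 0‖ₑ ^ p + D * Y) := a2.trans (by gcongr)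
      _ ≤ C₁ * ((‖f 0‖ₑ ^ p + Y) + D * (‖f 0‖ₑ ^ p + Y)) := by
        gcongr
        · exact le_self_add
        · exact le_add_self
      _ = (C₁ * (1 + D)) * (‖f 0‖ₑ ^ p + Y) := by ring
      _ ≤ _ := by gcongr; exact le_add_self

lemma bt_iff {a G Y C : ℝ≥0∞} {p : ℝ} (hp : 0 < p) (ha : a ≠ ⊤) (hC : C ≠ ⊤)
    (h1 : a + Y ^ (1/p) ≤ C * G) (h2 : G ≤ C * (a + Y ^ (1/p))) : G < ⊤ ↔ Y < ⊤ := by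
  have hp' : 0 < 1/p := by positivity
  constructor
  · intro h
    have h3 : Y ^ (1/p) < ⊤ := lt_of_le_of_lt (le_add_self.trans h1) (ENNReal.mul_lt_top hC.lt_top h)
    exact (ENNReal.rpow_lt_top_iff_of_pos hp').1 h3
  · intro h
    have h3 := (ENNReal.rpow_lt_top_iff_of_pos hp').2 h
    exact lt_of_le_of_lt h2 (ENNReal.mul_lt_top hC.lt_top (ENNReal.add_lt_top.2 ⟨ha.lt_top, h3⟩))

lemma bt_measA_congr (n : ℕ) (α : ℝ) {F G : En n → ℝ≥0∞} (h : ∀ z, ‖z‖ < 1 → F z = G z) :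
    ∫⁻ z, F z ∂measA n α = ∫⁻ z, G z ∂measA n α := by
  rw [bt_measA, bt_measA]
  congr 1
  apply setLIntegral_congr_fun measurableSet_ball
  intro z hz
  beta_reduce
  rw [h z (by simpa using hz)]

end final


/-- Tent space characterization of the generalized Bergman spaces via
area and maximal functions of `R^k f`. -/
theorem stmt10 (n : ℕ) (hn : 1 ≤ n) (γ q α p : ℝ) (k : ℕ) (hγ : 0 < γ) (hq : 1 < q)
    (hp : 0 < p) (hk : p * k + α > -1) :
    ∃ C : ℝ≥0∞, 0 < C ∧ C < ⊤ ∧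
      ∀ f : En n → ℂ, DifferentiableOn ℂ f (uball n) →
        ((gapnorm n p α f < ⊤ ↔
            (∫⁻ z, (areaF γ q
              (fun u => (1 - ‖u‖ ^ 2) ^ (k : ℝ) * ‖radIter k f u‖) z) ^ p ∂measA n α) < ⊤) ∧
         (gapnorm n p α f < ⊤ ↔
            (∫⁻ z, (maxHL γ q α
              (fun u => (1 - ‖u‖ ^ 2) ^ (k : ℝ) * ‖radIter k f u‖) z) ^ p ∂measA n α) < ⊤) ∧
         (C⁻¹ * (ENNReal.ofReal ‖f 0‖ +
              (∫⁻ z, (areaF γ q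
                (fun u => (1 - ‖u‖ ^ 2) ^ (k : ℝ) * ‖radIter k f u‖) z) ^ p
                ∂measA n α) ^ (1 / p)) ≤ gapnorm n p α f ∧
          gapnorm n p α f ≤ C * (ENNReal.ofReal ‖f 0‖ +
              (∫⁻ z, (areaF γ q
                (fun u => (1 - ‖u‖ ^ 2) ^ (k : ℝ) * ‖radIter k f u‖) z) ^ p
                ∂measA n α) ^ (1 / p))) ∧
         (C⁻¹ * (ENNReal.ofReal ‖f 0‖ +
              (∫⁻ z, (maxHL γ q α
                (fun u => (1 - ‖u‖ ^ 2) ^ (k : ℝ) * ‖radIter k f u‖) z) ^ p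
                ∂measA n α) ^ (1 / p)) ≤ gapnorm n p α f ∧
          gapnorm n p α f ≤ C * (ENNReal.ofReal ‖f 0‖ +
              (∫⁻ z, (maxHL γ q α
                (fun u => (1 - ‖u‖ ^ 2) ^ (k : ℝ) * ‖radIter k f u‖) z) ^ p
                ∂measA n α) ^ (1 / p)))) := by
  obtain ⟨C₁, hC₁, H₁⟩ := btAr_cmp (vol n) (show 0 < q by linarith) (btK_gt hγ) (k:ℝ)
  obtain ⟨C₂, hC₂, H₂⟩ := btMx_cmp (vol n) (show 0 < q by linarith) (btK_gt hγ) (k:ℝ) α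
  obtain ⟨D₁, hD₁, G₁⟩ := bt_main n hn α p k hp hk (256 * btK γ * btK γ) hC₁
  obtain ⟨D₂, hD₂, G₂⟩ := bt_main n hn α p k hp hk (256 * btK γ * btK γ) hC₂
  have hCt : D₁ + D₂ + 1 ≠ ⊤ := by finiteness
  have hC0 : D₁ + D₂ + 1 ≠ 0 := by simp
  refine ⟨D₁ + D₂ + 1, pos_iff_ne_zero.2 hC0, hCt.lt_top, fun f hf => ?_⟩
  have e1 : ∫⁻ z, (areaF γ q (fun u => (1 - ‖u‖ ^ 2) ^ (k : ℝ) * ‖radIter k f u‖) z) ^ p ∂measA n α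
      = ∫⁻ z, (btAr (vol n) (btK γ) q k (btIt k f) z) ^ p ∂measA n α :=
    bt_measA_congr n α fun z hz => by rw [bt_areaF hγ q k f hz]
  have e2 : ∫⁻ z, (maxHL γ q α (fun u => (1 - ‖u‖ ^ 2) ^ (k : ℝ) * ‖radIter k f u‖) z) ^ p ∂measA n α
      = ∫⁻ z, (btMx (vol n) (btK γ) q k α (btIt k f) z) ^ p ∂measA n α :=
    bt_measA_congr n α fun z hz => by rw [bt_maxHL hγ q α k f z]
  rw [e1, e2]
  obtain ⟨a1, a2⟩ := G₁ f hf _ (H₁ _ (btIt_diff hf k))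
  obtain ⟨b1, b2⟩ := G₂ f hf _ (H₂ _ (btIt_diff hf k))
  have l1 : D₁ ≤ D₁ + D₂ + 1 := by rw [add_assoc]; exact le_self_add
  have l2 : D₂ ≤ D₁ + D₂ + 1 := by rw [add_comm D₁, add_assoc]; exact le_self_add
  refine ⟨bt_iff hp ENNReal.ofReal_ne_top hD₁ a1 a2, bt_iff hp ENNReal.ofReal_ne_top hD₂ b1 b2,
    ⟨?_, a2.trans (by gcongr)⟩, ⟨?_, b2.trans (by gcongr)⟩⟩
  · rw [ENNReal.inv_mul_le_iff hC0 hCt]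
    exact a1.trans (by gcongr)
  · rw [ENNReal.inv_mul_le_iff hC0 hCt]
    exact b1.trans (by gcongr)
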